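/- arXiv:2502.06414 — 2 statements merged into one kernel-verified Lean document; each statement's English description precedes it below -/
import Mathlib

section
/- There exists a constant C depending only on n such that for every Lipschitz function u : ℝⁿ → ℝ with compact support, ∑_Q δ_Q^{−2} ∫_Q |u(x) − L_Q(x)|² dx ≤ C ∫_{ℝⁿ} |∇u(x)|² dx, where the sum ranges over all dyadic cubes Q of ℝⁿ (cubes of the form 2^{−j}(k + [0,1]^n) with j ∈ ℤ and k ∈ ℤⁿ). -/
open MeasureTheory NNReal

noncomputable section

/-- The dyadic cube of `ℝⁿ` indexed by a scale `j = p.1 ∈ ℤ` and a corner `k = p.2 ∈ ℤⁿ`: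
it has sidelength `2^{-j}`. -/
def dyadicCubeZ (n : ℕ) (p : ℤ × (Fin n → ℤ)) : Set (EuclideanSpace ℝ (Fin n)) :=
  {x | ∀ i, (p.2 i : ℝ) * (2 : ℝ) ^ (-p.1) ≤ x i ∧
        x i ≤ ((p.2 i : ℝ) + 1) * (2 : ℝ) ^ (-p.1)}

/-- `L` is an affine function on `ℝⁿ` (a linear function including a constant term). -/
def IsAffineFn {n : ℕ} (L : EuclideanSpace ℝ (Fin n) → ℝ) : Prop :=
  ∃ (a : Fin n → ℝ) (b : ℝ), L = fun x => (∑ i, a i * x i) + b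

/-- `L` is the affine function best approximating `u` in `L²(Q)`. -/
def IsBestAffineApprox {n : ℕ} (u : EuclideanSpace ℝ (Fin n) → ℝ)
    (Q : Set (EuclideanSpace ℝ (Fin n))) (L : EuclideanSpace ℝ (Fin n) → ℝ) : Prop :=
  IsAffineFn L ∧ ∀ L', IsAffineFn L' →
    ∫ x in Q, (u x - L x) ^ 2 ∂volume ≤ ∫ x in Q, (u x - L' x) ^ 2 ∂volume

section Differences

theorem integral_sq_add_le {α : Type*} [MeasurableSpace α] {μ : Measure α} {f g : α → ℝ}
    (hf : MemLp f 2 μ) (hg : MemLp g 2 μ) :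
    ∫ x, (f x + g x) ^ 2 ∂μ ≤ 2 * ∫ x, f x ^ 2 ∂μ + 2 * ∫ x, g x ^ 2 ∂μ := by
  rw [← integral_const_mul, ← integral_const_mul,
    ← integral_add (hf.integrable_sq.const_mul 2) (hg.integrable_sq.const_mul 2)]
  refine integral_mono (hf.add hg).integrable_sq
    ((hf.integrable_sq.const_mul 2).add (hg.integrable_sq.const_mul 2)) fun x => ?_
  simp only
  nlinarith [sq_nonneg (f x - g x)]

variable {E : Type*} [NormedAddCommGroup E] [MeasurableSpace E]

/-- The squared `L²` norm of the first difference of `u` with step `h`. -/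
def sqFirstDiff (μ : Measure E) (u : E → ℝ) (h : E) : ℝ :=
  ∫ x, (u (x + h) - u x) ^ 2 ∂μ

/-- The squared `L²` norm of the second difference of `u` with step `h`. -/
def sqSecondDiff (μ : Measure E) (u : E → ℝ) (h : E) : ℝ :=
  ∫ x, (u (x + (h + h)) - 2 * u (x + h) + u x) ^ 2 ∂μ

/-- The squared `L²` norm of the mixed second difference of `u` with steps `h` and `k`. -/
def sqMixedDiff (μ : Measure E) (u : E → ℝ) (h k : E) : ℝ :=
  ∫ x, (u (x + (h + k)) - u (x + h) - u (x + k) + u x) ^ 2 ∂μ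

theorem sqSecondDiff_nonneg (μ : Measure E) (u : E → ℝ) (h : E) : 0 ≤ sqSecondDiff μ u h :=
  integral_nonneg fun _ => sq_nonneg _

theorem sqFirstDiff_nonneg (μ : Measure E) (u : E → ℝ) (h : E) : 0 ≤ sqFirstDiff μ u h :=
  integral_nonneg fun _ => sq_nonneg _

variable [BorelSpace E]

theorem memLp_two_translate {μ : Measure E} [μ.IsAddHaarMeasure] {u : E → ℝ}
    (hu : MemLp u 2 μ) (a : E) : MemLp (fun x => u (x + a)) 2 μ :=
  hu.comp_measurePreserving (measurePreserving_add_right μ a)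

variable {μ : Measure E} [μ.IsAddHaarMeasure] {u : E → ℝ}

theorem sqSecondDiff_add_sqFirstDiff (hu : MemLp u 2 μ) (h : E) :
    sqSecondDiff μ u h + sqFirstDiff μ u (h + h) = 4 * sqFirstDiff μ u h := by
  have T := memLp_two_translate hu
  have key : ∫ x, (u (x + h + h) - u (x + h)) ^ 2 ∂μ = sqFirstDiff μ u h :=
    integral_add_right_eq_self (μ := μ) (fun x => (u (x + h) - u x) ^ 2) h
  have i1 := ((((T (h + h)).sub ((T h).const_mul 2)).add hu)).integrable_sq
  have i2 := ((T (h + h)).sub hu).integrable_sq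
  have i3 := ((T (h + h)).sub (T h)).integrable_sq
  have i4 := ((T h).sub hu).integrable_sq
  have : sqSecondDiff μ u h + sqFirstDiff μ u (h + h)
      = 2 * ∫ x, (u (x + h + h) - u (x + h)) ^ 2 ∂μ + 2 * sqFirstDiff μ u h := by
    simp only [sqSecondDiff, sqFirstDiff, add_assoc]
    rw [← integral_const_mul, ← integral_const_mul]
    refine (integral_add i1 i2).symm.trans (Eq.trans ?_
      (integral_add (i3.const_mul 2) (i4.const_mul 2)))
    refine integral_congr_ae (.of_forall fun x => ?_)
    simp only [Pi.add_apply, Pi.sub_apply]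
    ring
  rw [this, key]
  ring

variable [NormedSpace ℝ E]

/-- The squared `L²` norm of the defect of linear interpolation of `u` between `x` and `x + h`
at the parameter `t`. -/
def sqInterpDefect (μ : Measure E) (u : E → ℝ) (h : E) (t : ℝ) : ℝ :=
  ∫ x, (u (x + t • h) - u x - t * (u (x + h) - u x)) ^ 2 ∂μ

/-- The squared `L²` norm, in the base point `x`, of the defect at `x + r ∑ tᵢ eᵢ` of the affine
function through the values of `u` at `x` and the points `x + r eᵢ`. -/
def sqAffineDefect {ι : Type*} (μ : Measure E) (u : E → ℝ) (e : ι → E) (S : Finset ι)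
    (r : ℝ) (t : ι → ℝ) : ℝ :=
  ∫ x, (u (x + r • ∑ i ∈ S, t i • e i) - u x - ∑ i ∈ S, t i * (u (x + r • e i) - u x)) ^ 2 ∂μ

theorem sqFirstDiff_le_four_pow_mul (hu : MemLp u 2 μ) (h : E) (m : ℕ) :
    sqFirstDiff μ u h ≤ 4 ^ m * sqFirstDiff μ u ((2⁻¹ : ℝ) ^ m • h) := by
  induction m with
  | zero => simp
  | succ m ih =>
    refine ih.trans ?_
    have h1 := sqSecondDiff_add_sqFirstDiff hu ((2⁻¹ : ℝ) ^ (m + 1) • h)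
    have h2 := sqSecondDiff_nonneg μ u ((2⁻¹ : ℝ) ^ (m + 1) • h)
    have h3 : (2⁻¹ : ℝ) ^ (m + 1) • h + (2⁻¹ : ℝ) ^ (m + 1) • h = (2⁻¹ : ℝ) ^ m • h := by
      rw [← add_smul]; congr 1; ring
    rw [h3] at h1
    rw [pow_succ, mul_assoc]
    gcongr
    linarith

theorem integrable_sq_norm_fderiv {K : ℝ≥0} (hK : LipschitzWith K u) (hc : HasCompactSupport u) :
    Integrable (fun x => ‖fderiv ℝ u x‖ ^ 2) μ := by
  have hm : AEStronglyMeasurable (fun x => ‖fderiv ℝ u x‖ ^ 2) μ :=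
    ((measurable_fderiv ℝ u).norm.pow_const 2).aestronglyMeasurable
  have hs : HasCompactSupport (fun x => ‖fderiv ℝ u x‖ ^ 2) :=
    (hc.fderiv ℝ).comp_left (g := fun l : E →L[ℝ] ℝ => ‖l‖ ^ 2) (by simp)
  refine (integrableOn_iff_integrable_of_support_subset (subset_tsupport _)).1 ?_
  refine Measure.integrableOn_of_bounded (M := (K : ℝ) ^ 2) hs.isCompact.measure_lt_top.ne hm
    (.of_forall fun x => ?_)
  rw [Real.norm_of_nonneg (by positivity)]
  gcongr
  exact norm_fderiv_le_of_lipschitz ℝ hK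

theorem sqMixedDiff_le (hu : MemLp u 2 μ) (h k : E) :
    sqMixedDiff μ u h k ≤ 2 * sqSecondDiff μ u ((2⁻¹ : ℝ) • (h + k))
      + 2 * sqSecondDiff μ u ((2⁻¹ : ℝ) • (k - h)) := by
  have T := memLp_two_translate hu
  set a := (2⁻¹ : ℝ) • (h + k)
  set b := (2⁻¹ : ℝ) • (k - h)
  have key : ∫ x, (-(u (x + h + (b + b)) - 2 * u (x + h + b) + u (x + h))) ^ 2 ∂μ
      = sqSecondDiff μ u b := by
    simp only [neg_sq]
    exact integral_add_right_eq_self (μ := μ)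
      (fun x => (u (x + (b + b)) - 2 * u (x + b) + u x) ^ 2) h
  have ha : a + a = h + k := by
    rw [← add_smul]; norm_num
  have hb : b + b = k - h := by
    rw [← add_smul]; norm_num
  have hab : h + b = a := by
    simp only [a, b]
    module
  rw [← key]
  refine le_trans (le_of_eq ?_) (integral_sq_add_le
    (((T (a + a)).sub ((T a).const_mul 2)).add hu)
    ((((T (h + (b + b))).sub ((T (h + b)).const_mul 2)).add (T h)).neg) |>.trans_eq ?_)
  · refine integral_congr_ae (.of_forall fun x => ?_)
    simp only [Pi.add_apply, Pi.sub_apply, Pi.neg_apply, ha, hb, hab, add_sub_cancel]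
    ring
  · simp only [Pi.add_apply, Pi.sub_apply, Pi.neg_apply, ← add_assoc, sqSecondDiff]

/-- Doubling the step replaces the interpolation parameter `t` by the fractional part of `2t`. -/
theorem exists_sqInterpDefect_add_self_le (hu : MemLp u 2 μ) {t : ℝ} (ht : t ∈ Set.Icc (0 : ℝ) 1) :
    ∃ t' ∈ Set.Icc (0 : ℝ) 1, ∀ h : E, sqInterpDefect μ u (h + h) t
      ≤ 2 * sqInterpDefect μ u h t' + sqSecondDiff μ u h := by
  have T := memLp_two_translate hu
  have bound : ∀ c : ℝ, c ^ 2 ≤ 1 / 4 → ∀ h : E,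
      2 * ∫ x, (c * (u (x + (h + h)) - 2 * u (x + h) + u x)) ^ 2 ∂μ ≤ sqSecondDiff μ u h := by
    intro c hc h
    simp only [mul_pow]
    rw [integral_const_mul]
    have := mul_le_mul_of_nonneg_right hc (sqSecondDiff_nonneg μ u h)
    have h0 := sqSecondDiff_nonneg μ u h
    rw [sqSecondDiff] at *
    linarith
  have S : ∀ (h : E) (c : ℝ), MemLp (fun x => c * (u (x + (h + h)) - 2 * u (x + h) + u x)) 2 μ :=
    fun h c => (((T (h + h)).sub ((T h).const_mul 2)).add hu).const_mul c
  have I : ∀ (h : E) (c : ℝ), MemLp (fun x => u (x + c • h) - u x - c * (u (x + h) - u x)) 2 μ :=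
    fun h c => ((T (c • h)).sub hu).sub (((T h).sub hu).const_mul c)
  rcases le_total t (1 / 2) with h2 | h2
  · refine ⟨2 * t, ⟨by linarith [ht.1], by linarith⟩, fun h => ?_⟩
    refine le_trans (le_of_eq ?_) ((integral_sq_add_le (I h (2 * t)) (S h (-t))).trans
      (add_le_add le_rfl (bound (-t) (by nlinarith [ht.1]) h)))
    refine integral_congr_ae (.of_forall fun x => ?_)
    have : t • (h + h) = (2 * t) • h := by module
    simp only [this]
    ring
  · refine ⟨2 * t - 1, ⟨by linarith [ht.1], by linarith [ht.2]⟩, fun h => ?_⟩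
    have key : ∫ x, (u (x + h + (2 * t - 1) • h) - u (x + h)
        - (2 * t - 1) * (u (x + h + h) - u (x + h))) ^ 2 ∂μ = sqInterpDefect μ u h (2 * t - 1) :=
      integral_add_right_eq_self (μ := μ)
        (fun x => (u (x + (2 * t - 1) • h) - u x - (2 * t - 1) * (u (x + h) - u x)) ^ 2) h
    rw [← key]
    refine le_trans (le_of_eq ?_) ((integral_sq_add_le
      (memLp_two_translate (I h (2 * t - 1)) h) (S h (t - 1))).trans
      (add_le_add le_rfl (bound (t - 1) (by nlinarith [ht.2]) h)))
    refine integral_congr_ae (.of_forall fun x => ?_)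
    have : h + (2 * t - 1) • h = t • (h + h) := by module
    simp only [add_assoc, this]
    ring

variable [FiniteDimensional ℝ E]

theorem sqFirstDiff_le {K : ℝ≥0} (hK : LipschitzWith K u) (hc : HasCompactSupport u) (h : E) :
    sqFirstDiff μ u h ≤ ‖h‖ ^ 2 * ∫ x, ‖fderiv ℝ u x‖ ^ 2 ∂μ := by
  have hu : MemLp u 2 μ := hK.continuous.memLp_of_hasCompactSupport hc
  set F : ℕ → E → ℝ := fun m x => (2 ^ m * (u (x + (2⁻¹ : ℝ) ^ m • h) - u x)) ^ 2 with hF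
  have hlim : Filter.Tendsto (fun m => ∫ x, F m x ∂μ) Filter.atTop
      (nhds (∫ x, (fderiv ℝ u x h) ^ 2 ∂μ)) := by
    refine tendsto_integral_of_dominated_convergence
      ((Metric.cthickening ‖h‖ (tsupport u)).indicator fun _ => ((K : ℝ) * ‖h‖) ^ 2) ?_ ?_ ?_ ?_
    · intro m
      have := hK.continuous
      exact Continuous.aestronglyMeasurable (by fun_prop)
    · rw [integrable_indicator_iff Metric.isClosed_cthickening.measurableSet]
      exact integrableOn_const hc.isCompact.cthickening.measure_lt_top.ne
    · intro m
      refine .of_forall fun x => ?_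
      have hle : ‖(2⁻¹ : ℝ) ^ m • h‖ ≤ ‖h‖ := by
        rw [norm_smul]
        refine mul_le_of_le_one_left (norm_nonneg _) ?_
        rw [norm_pow]
        exact pow_le_one₀ (norm_nonneg _) (by norm_num)
      by_cases hx : x ∈ Metric.cthickening ‖h‖ (tsupport u)
      · rw [Set.indicator_of_mem hx, Real.norm_of_nonneg (sq_nonneg _)]
        refine sq_le_sq' ?_ ?_ <;>
        · have h1 := hK.dist_le_mul (x + (2⁻¹ : ℝ) ^ m • h) x
          rw [Real.dist_eq, dist_eq_norm, add_sub_cancel_left, norm_smul, norm_pow, norm_inv,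
            Real.norm_ofNat] at h1
          have h2 := abs_le.1 h1
          have h3 : (2 : ℝ) ^ m * (K * (2⁻¹ ^ m * ‖h‖)) = K * ‖h‖ := by
            rw [inv_pow]; field_simp
          have h4 : (0 : ℝ) < 2 ^ m := by positivity
          have h5 := mul_le_mul_of_nonneg_left h2.1 h4.le
          have h6 := mul_le_mul_of_nonneg_left h2.2 h4.le
          rw [h3] at h6
          rw [mul_neg, h3] at h5
          assumption
      · have z : ∀ y, dist x y ≤ ‖h‖ → u y = 0 := fun y hy => by
          by_contra hne
          exact hx (Metric.mem_cthickening_of_dist_le x y _ _ (subset_tsupport _ hne) hy)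
        rw [Set.indicator_of_notMem hx]
        simp only [hF]
        rw [z x (by simp), z _ (by rwa [dist_self_add_right])]
        simp
    · filter_upwards [hK.ae_differentiableAt (μ := μ)] with x hx
      refine Filter.Tendsto.pow ?_ 2
      have := hx.hasFDerivAt.lim h (c := fun m : ℕ => (2 : ℝ) ^ m) (l := Filter.atTop) ?_
      · simpa [inv_pow] using this
      · simp only [norm_pow, Real.norm_ofNat]
        exact tendsto_pow_atTop_atTop_of_one_lt one_lt_two
  have hle : ∀ m, sqFirstDiff μ u h ≤ ∫ x, F m x ∂μ := fun m => by
    refine (sqFirstDiff_le_four_pow_mul hu h m).trans_eq ?_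
    rw [sqFirstDiff, ← integral_const_mul]
    refine integral_congr_ae (.of_forall fun x => ?_)
    simp only [hF, mul_pow, ← pow_mul]
    rw [mul_comm m 2, pow_mul]
    norm_num
  refine (ge_of_tendsto' hlim hle).trans ?_
  rw [← integral_const_mul]
  refine integral_mono_of_nonneg (.of_forall fun x => sq_nonneg _)
    ((integrable_sq_norm_fderiv hK hc).const_mul _) (.of_forall fun x => ?_)
  simp only
  rw [← mul_pow, ← sq_abs]
  gcongr
  rw [mul_comm]
  exact (fderiv ℝ u x).le_opNorm h

/-- Telescoping bound for the second differences at the scales `s, 2s, 4s, …`. -/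
theorem sum_sqSecondDiff_le {K : ℝ≥0} (hK : LipschitzWith K u) (hc : HasCompactSupport u)
    {s : ℝ} (hs : 0 < s) (h : E) (m : ℕ) :
    ∑ i ∈ Finset.range m, ((s * 2 ^ i) ^ 2)⁻¹ * sqSecondDiff μ u ((s * 2 ^ i) • h)
      ≤ 4 * ‖h‖ ^ 2 * ∫ x, ‖fderiv ℝ u x‖ ^ 2 ∂μ := by
  have hu : MemLp u 2 μ := hK.continuous.memLp_of_hasCompactSupport hc
  have key : ∀ i, ((s * 2 ^ i) ^ 2)⁻¹ * sqSecondDiff μ u ((s * 2 ^ i) • h)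
      = 4 * ((s * 2 ^ i) ^ 2)⁻¹ * sqFirstDiff μ u ((s * 2 ^ i) • h)
        - 4 * ((s * 2 ^ (i + 1)) ^ 2)⁻¹ * sqFirstDiff μ u ((s * 2 ^ (i + 1)) • h) := fun i => by
    have h1 := sqSecondDiff_add_sqFirstDiff hu ((s * 2 ^ i) • h)
    have h2 : (s * 2 ^ i) • h + (s * 2 ^ i) • h = (s * 2 ^ (i + 1)) • h := by
      rw [← add_smul]; congr 1; ring
    rw [h2] at h1
    rw [eq_sub_of_add_eq h1]
    field_simp
    ring
  rw [Finset.sum_congr rfl fun i _ => key i, Finset.sum_range_sub']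
  have h3 : 0 ≤ 4 * ((s * 2 ^ m) ^ 2)⁻¹ * sqFirstDiff μ u ((s * 2 ^ m) • h) :=
    mul_nonneg (by positivity) (sqFirstDiff_nonneg _ _ _)
  have h4 := sqFirstDiff_le (μ := μ) hK hc (s • h)
  rw [norm_smul, Real.norm_of_nonneg hs.le] at h4
  simp only [pow_zero, mul_one]
  refine (sub_le_self _ h3).trans ?_
  refine (mul_le_mul_of_nonneg_left h4 (by positivity)).trans_eq ?_
  field_simp

theorem sum_sqMixedDiff_le {K : ℝ≥0} (hK : LipschitzWith K u) (hc : HasCompactSupport u)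
    {s : ℝ} (hs : 0 < s) (h k : E) (m : ℕ) :
    ∑ i ∈ Finset.range m,
        ((s * 2 ^ i) ^ 2)⁻¹ * sqMixedDiff μ u ((s * 2 ^ i) • h) ((s * 2 ^ i) • k)
      ≤ 4 * (‖h‖ + ‖k‖) ^ 2 * ∫ x, ‖fderiv ℝ u x‖ ^ 2 ∂μ := by
  have hu : MemLp u 2 μ := hK.continuous.memLp_of_hasCompactSupport hc
  have hD : 0 ≤ ∫ x, ‖fderiv ℝ u x‖ ^ 2 ∂μ := integral_nonneg fun _ => sq_nonneg _
  have h1 := sum_sqSecondDiff_le (μ := μ) hK hc hs ((2⁻¹ : ℝ) • (h + k)) m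
  have h2 := sum_sqSecondDiff_le (μ := μ) hK hc hs ((2⁻¹ : ℝ) • (k - h)) m
  have n1 : ‖(2⁻¹ : ℝ) • (h + k)‖ ^ 2 ≤ (‖h‖ + ‖k‖) ^ 2 / 4 := by
    rw [norm_smul, mul_pow, norm_inv, Real.norm_ofNat]
    have := pow_le_pow_left₀ (norm_nonneg _) (norm_add_le h k) 2
    linarith
  have n2 : ‖(2⁻¹ : ℝ) • (k - h)‖ ^ 2 ≤ (‖h‖ + ‖k‖) ^ 2 / 4 := by
    rw [norm_smul, mul_pow, norm_inv, Real.norm_ofNat]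
    have := pow_le_pow_left₀ (norm_nonneg _) (norm_sub_le k h) 2
    rw [add_comm ‖k‖] at this
    linarith
  have h3 := mul_le_mul_of_nonneg_right n1 hD
  have h4 := mul_le_mul_of_nonneg_right n2 hD
  refine (Finset.sum_le_sum fun i _ => mul_le_mul_of_nonneg_left
    (sqMixedDiff_le hu ((s * 2 ^ i) • h) ((s * 2 ^ i) • k)) (by positivity)).trans ?_
  have e : ∀ i : ℕ, ((s * 2 ^ i) ^ 2)⁻¹ *
      (2 * sqSecondDiff μ u ((2⁻¹ : ℝ) • ((s * 2 ^ i) • h + (s * 2 ^ i) • k))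
        + 2 * sqSecondDiff μ u ((2⁻¹ : ℝ) • ((s * 2 ^ i) • k - (s * 2 ^ i) • h)))
      = 2 * (((s * 2 ^ i) ^ 2)⁻¹ * sqSecondDiff μ u ((s * 2 ^ i) • (2⁻¹ : ℝ) • (h + k)))
        + 2 * (((s * 2 ^ i) ^ 2)⁻¹ * sqSecondDiff μ u ((s * 2 ^ i) • (2⁻¹ : ℝ) • (k - h))) :=
    fun i => by
      rw [← smul_add, ← smul_sub, smul_comm (2⁻¹ : ℝ), smul_comm (2⁻¹ : ℝ)]
      ring
  rw [Finset.sum_congr rfl fun i _ => e i, Finset.sum_add_distrib, ← Finset.mul_sum,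
    ← Finset.mul_sum]
  linarith

theorem sqInterpDefect_le {K : ℝ≥0} (hK : LipschitzWith K u) (hc : HasCompactSupport u)
    (h : E) {t : ℝ} (ht : t ∈ Set.Icc (0 : ℝ) 1) :
    sqInterpDefect μ u h t ≤ 4 * ‖h‖ ^ 2 * ∫ x, ‖fderiv ℝ u x‖ ^ 2 ∂μ := by
  have hu : MemLp u 2 μ := hK.continuous.memLp_of_hasCompactSupport hc
  have T := memLp_two_translate hu
  have hD : 0 ≤ ‖h‖ ^ 2 * ∫ x, ‖fderiv ℝ u x‖ ^ 2 ∂μ :=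
    mul_nonneg (sq_nonneg _) (integral_nonneg fun _ => sq_nonneg _)
  have h1 := sqFirstDiff_le (μ := μ) hK hc (t • h)
  have h2 := sqFirstDiff_le (μ := μ) hK hc h
  have h3 := integral_sq_add_le ((T (t • h)).sub hu) (((T h).sub hu).const_mul (-t))
  have ht2 : t ^ 2 ≤ 1 := pow_le_one₀ ht.1 ht.2
  have e : sqInterpDefect μ u h t = ∫ x, ((u (x + t • h) - u x) + -t * (u (x + h) - u x)) ^ 2 ∂μ :=
    integral_congr_ae (.of_forall fun x => by ring)
  rw [e]
  refine h3.trans ?_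
  simp only [Pi.sub_apply, mul_pow, neg_sq]
  rw [integral_const_mul]
  rw [norm_smul, Real.norm_of_nonneg ht.1, mul_pow, mul_assoc] at h1
  have h4 := mul_le_mul_of_nonneg_right ht2 hD
  have h5 := mul_le_mul_of_nonneg_right ht2 (sqFirstDiff_nonneg μ u h)
  rw [sqFirstDiff] at h1 h2 h5
  linarith

theorem sum_sqInterpDefect_le {K : ℝ≥0} (hK : LipschitzWith K u) (hc : HasCompactSupport u)
    {s : ℝ} (hs : 0 < s) (h : E) (m : ℕ) {t : ℝ} (ht : t ∈ Set.Icc (0 : ℝ) 1) :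
    ∑ i ∈ Finset.range m, ((s * 2 ^ i) ^ 2)⁻¹ * sqInterpDefect μ u ((s * 2 ^ i) • h) t
      ≤ 16 * ‖h‖ ^ 2 * ∫ x, ‖fderiv ℝ u x‖ ^ 2 ∂μ := by
  have hu : MemLp u 2 μ := hK.continuous.memLp_of_hasCompactSupport hc
  have hD : 0 ≤ ‖h‖ ^ 2 * ∫ x, ‖fderiv ℝ u x‖ ^ 2 ∂μ :=
    mul_nonneg (sq_nonneg _) (integral_nonneg fun _ => sq_nonneg _)
  induction m generalizing t with
  | zero => simp only [Finset.range_zero, Finset.sum_empty]; linarith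
  | succ m ih =>
    obtain ⟨t', ht', H⟩ := exists_sqInterpDefect_add_self_le hu ht
    have step : ∀ i : ℕ, ((s * 2 ^ (i + 1)) ^ 2)⁻¹ *
          sqInterpDefect μ u ((s * 2 ^ (i + 1)) • h) t
        ≤ 2⁻¹ * (((s * 2 ^ i) ^ 2)⁻¹ * sqInterpDefect μ u ((s * 2 ^ i) • h) t')
          + 4⁻¹ * (((s * 2 ^ i) ^ 2)⁻¹ * sqSecondDiff μ u ((s * 2 ^ i) • h)) := fun i => by
      have e : (s * 2 ^ i) • h + (s * 2 ^ i) • h = (s * 2 ^ (i + 1)) • h := by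
        rw [← add_smul]; congr 1; ring
      have h1 := H ((s * 2 ^ i) • h)
      rw [e] at h1
      refine (mul_le_mul_of_nonneg_left h1 (by positivity)).trans_eq ?_
      field_simp
      ring
    rw [Finset.sum_range_succ']
    have h0 := sqInterpDefect_le (μ := μ) hK hc (s • h) ht
    rw [norm_smul, Real.norm_of_nonneg hs.le] at h0
    have h0' : ((s * 2 ^ 0) ^ 2)⁻¹ * sqInterpDefect μ u ((s * 2 ^ 0) • h) t
        ≤ 4 * ‖h‖ ^ 2 * ∫ x, ‖fderiv ℝ u x‖ ^ 2 ∂μ := by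
      simp only [pow_zero, mul_one]
      refine (mul_le_mul_of_nonneg_left h0 (by positivity)).trans_eq ?_
      field_simp
    have h1 := Finset.sum_le_sum (s := Finset.range m) fun i _ => step i
    rw [Finset.sum_add_distrib, ← Finset.mul_sum, ← Finset.mul_sum] at h1
    have h2 := ih ht'
    have h3 := sum_sqSecondDiff_le (μ := μ) hK hc hs h m
    linarith

theorem exists_sum_sqAffineDefect_le {ι : Type*} (μ : Measure E) [μ.IsAddHaarMeasure]
    (e : ι → E) (he : ∀ i, ‖e i‖ ≤ 1) (S : Finset ι) :
    ∃ C : ℝ, 0 ≤ C ∧ ∀ (u : E → ℝ) (K : ℝ≥0), LipschitzWith K u → HasCompactSupport u →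
      ∀ s : ℝ, 0 < s → ∀ (m : ℕ) (t : ι → ℝ), (∀ i, t i ∈ Set.Icc (0 : ℝ) 1) →
      ∑ i ∈ Finset.range m, ((s * 2 ^ i) ^ 2)⁻¹ * sqAffineDefect μ u e S (s * 2 ^ i) t
        ≤ C * ∫ x, ‖fderiv ℝ u x‖ ^ 2 ∂μ := by
  classical
  induction S using Finset.induction_on with
  | empty => exact ⟨0, le_rfl, fun u K _ _ s _ m t _ => by simp [sqAffineDefect]⟩
  | insert a S ha ih =>
    obtain ⟨C, hC, H⟩ := ih
    refine ⟨2 * C + 4 * (16 + 4 * ((S.card : ℝ) + 1) ^ 2), by positivity,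
      fun u K hK hc s hs m t ht => ?_⟩
    have hu : MemLp u 2 μ := hK.continuous.memLp_of_hasCompactSupport hc
    have T := memLp_two_translate hu
    have hD : 0 ≤ ∫ x, ‖fderiv ℝ u x‖ ^ 2 ∂μ := integral_nonneg fun _ => sq_nonneg _
    have hte : ∀ i, ‖t i • e i‖ ≤ 1 := fun i => by
      rw [norm_smul, Real.norm_of_nonneg (ht i).1]
      exact mul_le_one₀ (ht i).2 (norm_nonneg _) (he i)
    have hsum : ‖∑ i ∈ S, t i • e i‖ ≤ S.card := by
      refine (norm_sum_le _ _).trans ?_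
      refine (Finset.sum_le_sum fun i _ => hte i).trans_eq (by simp)
    have step : ∀ r : ℝ, sqAffineDefect μ u e (insert a S) r t ≤ 2 * sqAffineDefect μ u e S r t
        + 4 * (sqInterpDefect μ u (r • e a) (t a)
          + sqMixedDiff μ u (r • ∑ i ∈ S, t i • e i) (r • t a • e a)) := fun r => by
      have m1 : MemLp (fun x => u (x + r • ∑ i ∈ S, t i • e i) - u x
          - ∑ i ∈ S, t i * (u (x + r • e i) - u x)) 2 μ :=
        ((T _).sub hu).sub (memLp_finsetSum _ fun i _ => ((T _).sub hu).const_mul _)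
      have m2 : MemLp (fun x => u (x + t a • r • e a) - u x - t a * (u (x + r • e a) - u x)) 2 μ :=
        ((T _).sub hu).sub (((T _).sub hu).const_mul _)
      have m3 : MemLp (fun x => u (x + (r • ∑ i ∈ S, t i • e i + r • t a • e a))
          - u (x + r • ∑ i ∈ S, t i • e i) - u (x + r • t a • e a) + u x) 2 μ :=
        (((T _).sub (T _)).sub (T _)).add hu
      have b1 := integral_sq_add_le m1 (m2.add m3)
      have b2 := integral_sq_add_le m2 m3
      refine le_trans (le_of_eq (integral_congr_ae (.of_forall fun x => ?_))) (b1.trans ?_)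
      · simp only [Pi.add_apply]
        rw [Finset.sum_insert ha, Finset.sum_insert ha, smul_add, smul_comm (t a) r,
          add_comm (r • t a • e a)]
        ring
      · simp only [Pi.add_apply, sqAffineDefect, sqInterpDefect, sqMixedDiff] at b2 ⊢
        linarith
    have h1 := H u K hK hc s hs m t ht
    have h2 := sum_sqInterpDefect_le (μ := μ) hK hc hs (e a) m (ht a)
    have h3 := sum_sqMixedDiff_le (μ := μ) hK hc hs (∑ i ∈ S, t i • e i) (t a • e a) m
    refine (Finset.sum_le_sum fun i _ => (mul_le_mul_of_nonneg_left (step (s * 2 ^ i))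
      (by positivity)).trans_eq (?_ : _ = 2 * (((s * 2 ^ i) ^ 2)⁻¹ *
        sqAffineDefect μ u e S (s * 2 ^ i) t) + 4 * (((s * 2 ^ i) ^ 2)⁻¹ *
        sqInterpDefect μ u ((s * 2 ^ i) • e a) (t a) + ((s * 2 ^ i) ^ 2)⁻¹ *
        sqMixedDiff μ u ((s * 2 ^ i) • ∑ i ∈ S, t i • e i) ((s * 2 ^ i) • t a • e a)))).trans ?_
    · ring
    rw [Finset.sum_add_distrib, ← Finset.mul_sum, ← Finset.mul_sum, Finset.sum_add_distrib]
    have b2 : 16 * ‖e a‖ ^ 2 * ∫ x, ‖fderiv ℝ u x‖ ^ 2 ∂μ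
        ≤ 16 * ∫ x, ‖fderiv ℝ u x‖ ^ 2 ∂μ := by
      gcongr
      have := pow_le_one₀ (n := 2) (norm_nonneg _) (he a)
      linarith
    have b3 : 4 * (‖∑ i ∈ S, t i • e i‖ + ‖t a • e a‖) ^ 2 * ∫ x, ‖fderiv ℝ u x‖ ^ 2 ∂μ
        ≤ 4 * ((S.card : ℝ) + 1) ^ 2 * ∫ x, ‖fderiv ℝ u x‖ ^ 2 ∂μ := by
      gcongr
      exact hte a
    linarith

end Differences

section Cubes

variable {n : ℕ}

/-- The unit cube `[0,1]ⁿ`. -/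
def unitBox (n : ℕ) : Set (EuclideanSpace ℝ (Fin n)) := {t | ∀ i, t i ∈ Set.Icc (0 : ℝ) 1}

theorem isClosed_unitBox : IsClosed (unitBox n) := by
  simp only [unitBox, Set.ofPred_forall]
  exact isClosed_iInter fun i => isClosed_Icc.preimage (by fun_prop)

theorem volume_unitBox : volume (unitBox n) = 1 := by
  have h := (EuclideanSpace.volume_preserving_symm_measurableEquiv_toLp (Fin n)).measure_preimage
    (s := Set.univ.pi fun _ => Set.Icc (0 : ℝ) 1)
    (MeasurableSet.univ_pi fun _ => measurableSet_Icc).nullMeasurableSet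
  simp only [volume_pi_pi, Real.volume_Icc, sub_zero, ENNReal.ofReal_one,
    Finset.prod_const_one] at h
  rw [← h]
  congr 1
  ext t
  simp [unitBox, Pi.le_def, forall_and]

theorem measurableSet_dyadicCubeZ (p : ℤ × (Fin n → ℤ)) : MeasurableSet (dyadicCubeZ n p) := by
  have : IsClosed (dyadicCubeZ n p) := by
    simp only [dyadicCubeZ, Set.ofPred_forall, Set.ofPred_and]
    exact isClosed_iInter fun i => (isClosed_le (by fun_prop) (by fun_prop)).inter
      (isClosed_le (by fun_prop) (by fun_prop))
  exact this.measurableSet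

/-- Each point lies in at most `2ⁿ` closed dyadic cubes of a given scale. -/
theorem card_dyadicCubeZ_le (j : ℤ) (F : Finset (Fin n → ℤ)) (x : EuclideanSpace ℝ (Fin n))
    [DecidablePred fun k => x ∈ dyadicCubeZ n (j, k)] :
    (F.filter fun k => x ∈ dyadicCubeZ n (j, k)).card ≤ 2 ^ n := by
  set d : ℝ := 2 ^ (-j)
  have hd : 0 < d := by positivity
  have hsub : F.filter (fun k => x ∈ dyadicCubeZ n (j, k)) ⊆
      Fintype.piFinset fun i => {⌊x i / d⌋, ⌊x i / d⌋ - 1} := by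
    intro k hk
    rw [Fintype.mem_piFinset]
    intro i
    have h := (Finset.mem_filter.1 hk).2 i
    have h1 : (k i : ℝ) ≤ x i / d := (le_div_iff₀ hd).2 h.1
    have h2 : x i / d ≤ (k i : ℝ) + 1 := (div_le_iff₀ hd).2 h.2
    have h3 : k i ≤ ⌊x i / d⌋ := Int.le_floor.2 h1
    have h4 : ⌊x i / d⌋ ≤ k i + 1 := by
      have := Int.floor_le_floor h2
      rwa [show (k i : ℝ) + 1 = ((k i + 1 : ℤ) : ℝ) by push_cast; rfl, Int.floor_intCast] at this
    simp only [Finset.mem_insert, Finset.mem_singleton]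
    omega
  refine (Finset.card_le_card hsub).trans ?_
  rw [Fintype.card_piFinset]
  refine (Finset.prod_le_prod' fun i _ => Finset.card_le_two).trans_eq (by simp)

theorem sum_setLIntegral_dyadicCubeZ_le (j : ℤ) (F : Finset (Fin n → ℤ))
    {f : EuclideanSpace ℝ (Fin n) → ENNReal} (hf : Measurable f) :
    ∑ k ∈ F, ∫⁻ x in dyadicCubeZ n (j, k), f x ≤ 2 ^ n * ∫⁻ x, f x := by
  classical
  simp only [← lintegral_indicator (measurableSet_dyadicCubeZ _)]
  rw [← lintegral_finsetSum _ fun k _ => hf.indicator (measurableSet_dyadicCubeZ _),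
    ← lintegral_const_mul _ hf]
  refine lintegral_mono fun x => ?_
  simp only [Set.indicator_apply]
  rw [← Finset.sum_filter, Finset.sum_const, nsmul_eq_mul]
  gcongr
  exact_mod_cast card_dyadicCubeZ_le j F x

/-- The affine function through the values of `u` at `y` and the points `y + r eᵢ`. -/
def affineInterp (u : EuclideanSpace ℝ (Fin n) → ℝ) (r : ℝ) (y x : EuclideanSpace ℝ (Fin n)) : ℝ :=
  u y + ∑ i, (x i - y i) / r * (u (y + r • EuclideanSpace.single i 1) - u y)

theorem isAffineFn_affineInterp (u : EuclideanSpace ℝ (Fin n) → ℝ) (r : ℝ)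
    (y : EuclideanSpace ℝ (Fin n)) : IsAffineFn (affineInterp u r y) := by
  refine ⟨fun i => (u (y + r • EuclideanSpace.single i 1) - u y) / r,
    u y - ∑ i, y i / r * (u (y + r • EuclideanSpace.single i 1) - u y), funext fun x => ?_⟩
  rw [affineInterp, add_comm, sub_eq_add_neg, add_comm (u y), ← add_assoc, ← Finset.sum_neg_distrib,
    ← Finset.sum_add_distrib]
  congr 1
  refine Finset.sum_congr rfl fun i _ => ?_
  ring

theorem sub_affineInterp_add_smul (u : EuclideanSpace ℝ (Fin n) → ℝ) {r : ℝ} (hr : 0 < r)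
    (y t : EuclideanSpace ℝ (Fin n)) :
    u (y + r • t) - affineInterp u r y (y + r • t)
      = u (y + r • ∑ i, t i • EuclideanSpace.single i 1) - u y
        - ∑ i, t i * (u (y + r • EuclideanSpace.single i 1) - u y) := by
  have ht : ∑ i, t i • EuclideanSpace.single i (1 : ℝ) = t := by
    simpa using (EuclideanSpace.basisFun (Fin n) ℝ).sum_repr t
  rw [ht, affineInterp, sub_sub]
  congr 2
  refine Finset.sum_congr rfl fun i _ => ?_
  simp only [PiLp.add_apply, PiLp.smul_apply, smul_eq_mul, add_sub_cancel_left]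
  rw [mul_div_cancel_left₀ _ hr.ne']

theorem ofReal_integral_le_lintegral_ofReal {α : Type*} [MeasurableSpace α] {μ : Measure α}
    {f : α → ℝ} (hf : 0 ≤ f) : ENNReal.ofReal (∫ x, f x ∂μ) ≤ ∫⁻ x, ENNReal.ofReal (f x) ∂μ := by
  by_cases h : Integrable f μ
  · exact (ofReal_integral_eq_lintegral_ofReal h (.of_forall hf)).le
  · simp [integral_undef h]

theorem lintegral_add_smul {r : ℝ} (hr : 0 < r) (y : EuclideanSpace ℝ (Fin n))
    {f : EuclideanSpace ℝ (Fin n) → ENNReal} (hf : Measurable f) :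
    ∫⁻ x, f x = ENNReal.ofReal r ^ n * ∫⁻ t, f (y + r • t) := by
  have h1 : ∫⁻ t, f (y + r • t) = ∫⁻ z, f (y + z) ∂(Measure.map (r • ·) volume) :=
    (lintegral_map (hf.comp (measurable_const_add y)) (measurable_const_smul r)).symm
  rw [h1, Measure.map_addHaar_smul _ hr.ne', lintegral_smul_measure, lintegral_add_left_eq_self,
    finrank_euclideanSpace_fin, smul_eq_mul, ← mul_assoc, ← ENNReal.ofReal_pow hr.le,
    ← ENNReal.ofReal_mul (by positivity), abs_of_pos (by positivity),
    mul_inv_cancel₀ (by positivity), ENNReal.ofReal_one, one_mul]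

theorem measurable_sqAffineDefect {u : EuclideanSpace ℝ (Fin n) → ℝ} (hu : Continuous u) (r : ℝ) :
    Measurable fun t : EuclideanSpace ℝ (Fin n) =>
      sqAffineDefect volume u (fun i => EuclideanSpace.single i 1) Finset.univ r t := by
  simp only [sqAffineDefect]
  refine StronglyMeasurable.measurable (StronglyMeasurable.integral_prod_right'
    (f := fun p : EuclideanSpace ℝ (Fin n) × EuclideanSpace ℝ (Fin n) =>
      (u (p.2 + r • ∑ i, p.1 i • EuclideanSpace.single i 1) - u p.2
        - ∑ i, p.1 i * (u (p.2 + r • EuclideanSpace.single i 1) - u p.2)) ^ 2)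
    (Continuous.stronglyMeasurable ?_))
  fun_prop

theorem ofReal_sqAffineDefect {u : EuclideanSpace ℝ (Fin n) → ℝ} (hu : MemLp u 2 volume)
    {r : ℝ} (hr : 0 < r) (t : EuclideanSpace ℝ (Fin n)) :
    ENNReal.ofReal (sqAffineDefect volume u (fun i => EuclideanSpace.single i 1) Finset.univ r t)
      = ∫⁻ y, ENNReal.ofReal ((u (y + r • t) - affineInterp u r y (y + r • t)) ^ 2) := by
  have T := memLp_two_translate hu
  simp only [sub_affineInterp_add_smul u hr]
  refine ofReal_integral_eq_lintegral_ofReal (MemLp.integrable_sq ?_)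
    (.of_forall fun x => sq_nonneg _)
  exact ((T _).sub hu).sub (memLp_finsetSum _ fun i _ => ((T _).sub hu).const_mul _)

/-- The squared error of `affineInterp`, cut off to the points `x` in the cube `y + [0,r]ⁿ`. -/
def boxError (u : EuclideanSpace ℝ (Fin n) → ℝ) (r : ℝ) (y x : EuclideanSpace ℝ (Fin n)) :
    ENNReal :=
  (unitBox n).indicator (fun _ => ENNReal.ofReal ((u x - affineInterp u r y x) ^ 2))
    (r⁻¹ • (x - y))

theorem measurable_boxError {u : EuclideanSpace ℝ (Fin n) → ℝ} (hu : Continuous u) (r : ℝ) :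
    Measurable (Function.uncurry (boxError u r)) := by
  have h1 : Measurable fun p : EuclideanSpace ℝ (Fin n) × EuclideanSpace ℝ (Fin n) =>
      ENNReal.ofReal ((u p.2 - affineInterp u r p.1 p.2) ^ 2) := by
    refine ENNReal.measurable_ofReal.comp (Continuous.measurable ?_)
    unfold affineInterp
    fun_prop
  have h2 : MeasurableSet ((fun p : EuclideanSpace ℝ (Fin n) × EuclideanSpace ℝ (Fin n) =>
      r⁻¹ • (p.2 - p.1)) ⁻¹' unitBox n) :=
    (isClosed_unitBox.preimage (by fun_prop)).measurableSet
  exact h1.indicator h2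

theorem lintegral_lintegral_boxError_add_smul {u : EuclideanSpace ℝ (Fin n) → ℝ}
    (hu2 : MemLp u 2 volume) {r : ℝ} (hr : 0 < r) :
    ∫⁻ t, ∫⁻ y, boxError u r y (y + r • t) = ∫⁻ t in unitBox n, ENNReal.ofReal
      (sqAffineDefect volume u (fun i => EuclideanSpace.single i 1) Finset.univ r t) := by
  rw [← lintegral_indicator isClosed_unitBox.measurableSet]
  refine lintegral_congr fun t => ?_
  have h (y : EuclideanSpace ℝ (Fin n)) : r⁻¹ • (y + r • t - y) = t := by
    rw [add_sub_cancel_left, inv_smul_smul₀ hr.ne']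
  by_cases ht : t ∈ unitBox n
  · simp only [boxError, h, Set.indicator_of_mem ht, ofReal_sqAffineDefect hu2 hr]
  · simp only [boxError, h, Set.indicator_of_notMem ht, lintegral_zero]

theorem measurable_boxError_add_smul {u : EuclideanSpace ℝ (Fin n) → ℝ} (hu : Continuous u)
    (r : ℝ) : Measurable fun q : EuclideanSpace ℝ (Fin n) × EuclideanSpace ℝ (Fin n) =>
      boxError u r q.1 (q.1 + r • q.2) := by
  have h : Measurable fun q : EuclideanSpace ℝ (Fin n) × EuclideanSpace ℝ (Fin n) =>
      q.1 + r • q.2 := Continuous.measurable (by fun_prop)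
  have h2 := (measurable_boxError hu r).comp (measurable_fst.prodMk h)
  simpa only [Function.comp_def, Function.uncurry_apply_pair] using h2

theorem lintegral_boxError {u : EuclideanSpace ℝ (Fin n) → ℝ} (hu : Continuous u)
    (hu2 : MemLp u 2 volume) {r : ℝ} (hr : 0 < r) :
    ∫⁻ x, ∫⁻ y, boxError u r y x = ENNReal.ofReal r ^ n * ∫⁻ t in unitBox n, ENNReal.ofReal
      (sqAffineDefect volume u (fun i => EuclideanSpace.single i 1) Finset.univ r t) := by
  have hm := measurable_boxError hu r
  have hm2 := measurable_boxError_add_smul hu r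
  rw [lintegral_lintegral_swap (f := fun x y => boxError u r y x)
    (hm.comp measurable_swap).aemeasurable, ← lintegral_lintegral_boxError_add_smul hu2 hr,
    ← lintegral_lintegral_swap (f := fun y t => boxError u r y (y + r • t)) hm2.aemeasurable,
    ← lintegral_const_mul _ (hm2.lintegral_prod_right')]
  exact lintegral_congr fun y => lintegral_add_smul hr y (f := boxError u r y) hm.of_uncurry_left

theorem ofReal_integral_mul_le_lintegral_boxError {u : EuclideanSpace ℝ (Fin n) → ℝ}
    (hu : Continuous u) (p : ℤ × (Fin n → ℤ)) {L : EuclideanSpace ℝ (Fin n) → ℝ}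
    (hL : IsBestAffineApprox u (dyadicCubeZ n p) L) :
    ENNReal.ofReal (∫ x in dyadicCubeZ n p, (u x - L x) ^ 2) * ENNReal.ofReal (2 ^ (-p.1)) ^ n
      ≤ ∫⁻ x in dyadicCubeZ n p, ∫⁻ y, boxError u (2 * 2 ^ (-p.1)) y x := by
  set d : ℝ := 2 ^ (-p.1) with hd_def
  have hd : 0 < d := by positivity
  have hm := measurable_boxError hu (2 * d)
  set z : EuclideanSpace ℝ (Fin n) := WithLp.toLp 2 fun i => (p.2 i : ℝ) * d with hz
  set Y : Set (EuclideanSpace ℝ (Fin n)) := (fun y => z - y) ⁻¹' ((d⁻¹ • ·) ⁻¹' unitBox n) with hY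
  have hB : MeasurableSet ((d⁻¹ • · : EuclideanSpace ℝ (Fin n) → _) ⁻¹' unitBox n) :=
    (isClosed_unitBox.preimage (by fun_prop)).measurableSet
  have hYm : MeasurableSet Y := hB.preimage (by fun_prop)
  have hYvol : volume Y = ENNReal.ofReal d ^ n := by
    rw [hY, (Measure.measurePreserving_sub_left volume z).measure_preimage hB.nullMeasurableSet,
      Measure.addHaar_preimage_smul _ (inv_ne_zero hd.ne'), volume_unitBox, mul_one,
      finrank_euclideanSpace_fin, inv_pow, inv_inv, abs_of_pos (by positivity),
      ENNReal.ofReal_pow hd.le]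
  rw [← hYvol, ← setLIntegral_const, lintegral_lintegral_swap
    (f := fun x y => boxError u (2 * d) y x) (hm.comp measurable_swap).aemeasurable]
  refine le_trans ?_ (setLIntegral_le_lintegral Y _)
  refine setLIntegral_mono' hYm fun y hy => ?_
  refine (ENNReal.ofReal_le_ofReal (hL.2 _ (isAffineFn_affineInterp u (2 * d) y))).trans ?_
  refine (ofReal_integral_le_lintegral_ofReal fun x => sq_nonneg _).trans ?_
  refine setLIntegral_mono' (measurableSet_dyadicCubeZ p) fun x hx => ?_
  suffices hmem : (2 * d)⁻¹ • (x - y) ∈ unitBox n by rw [boxError, Set.indicator_of_mem hmem]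
  intro i
  have h1 := hx i
  have h2 := hy i
  rw [← hd_def] at h1
  simp only [hz, PiLp.smul_apply, PiLp.sub_apply, smul_eq_mul, Set.mem_Icc] at h2 ⊢
  have h3 := h2.1
  have h4 := h2.2
  rw [inv_mul_eq_div] at h3 h4 ⊢
  rw [le_div_iff₀ hd] at h3
  rw [div_le_iff₀ hd] at h4
  rw [le_div_iff₀ (by positivity), div_le_iff₀ (by positivity)]
  constructor <;> linarith [h1.1, h1.2]

theorem sum_ofReal_integral_dyadicCubeZ_le {u : EuclideanSpace ℝ (Fin n) → ℝ} (hu : Continuous u)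
    (hu2 : MemLp u 2 volume) (j : ℤ) (F : Finset (Fin n → ℤ))
    {L : (Fin n → ℤ) → EuclideanSpace ℝ (Fin n) → ℝ}
    (hL : ∀ k, IsBestAffineApprox u (dyadicCubeZ n (j, k)) (L k)) :
    ∑ k ∈ F, ENNReal.ofReal (∫ x in dyadicCubeZ n (j, k), (u x - L k x) ^ 2)
      ≤ 4 ^ n * ∫⁻ t in unitBox n, ENNReal.ofReal (sqAffineDefect volume u
        (fun i => EuclideanSpace.single i 1) Finset.univ (2 * 2 ^ (-j)) t) := by
  set d : ℝ := 2 ^ (-j)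
  have hd : 0 < d := by positivity
  have hd0 : ENNReal.ofReal d ^ n ≠ 0 := pow_ne_zero _ (by simpa using hd)
  have hdt : ENNReal.ofReal d ^ n ≠ ⊤ := by finiteness
  rw [← ENNReal.mul_le_mul_iff_left hd0 hdt, Finset.sum_mul]
  refine (Finset.sum_le_sum fun k _ =>
    ofReal_integral_mul_le_lintegral_boxError hu (j, k) (hL k)).trans ?_
  refine (sum_setLIntegral_dyadicCubeZ_le j F
    (f := fun x => ∫⁻ y, boxError u (2 * d) y x)
    (measurable_boxError hu (2 * d)).lintegral_prod_left').trans ?_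
  rw [lintegral_boxError hu hu2 (by positivity), ENNReal.ofReal_mul zero_le_two, mul_pow,
    ← mul_assoc, ← mul_assoc, ENNReal.ofReal_ofNat, ← mul_pow]
  norm_num1
  exact (mul_right_comm _ _ _).le

end Cubes

theorem sum_int_le_of_sum_range_le {f : ℤ → ℝ} (hf : ∀ j, 0 ≤ f j) {B : ℝ}
    (h : ∀ (N : ℤ) (m : ℕ), ∑ i ∈ Finset.range m, f (N - i) ≤ B) (J : Finset ℤ) :
    ∑ j ∈ J, f j ≤ B := by
  obtain ⟨N, hN⟩ := J.bddAbove
  obtain ⟨M, hM⟩ := J.bddBelow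
  refine le_trans ?_ (h N ((N - M).toNat + 1))
  rw [← Finset.sum_image (g := fun i : ℕ => N - (i : ℤ)) (f := f)
    (fun a _ b _ hab => by simpa using hab)]
  refine Finset.sum_le_sum_of_subset_of_nonneg (fun j hj => ?_) fun j _ _ => hf j
  have h1 := hN hj
  have h2 := hM hj
  exact Finset.mem_image.2 ⟨(N - j).toNat, by simp only [Finset.mem_range]; omega, by omega⟩

/-- There is a constant `C` depending only on `n` such that for every
compactly supported Lipschitz `u : ℝⁿ → ℝ`,
`∑_Q δ_Q^{-2} ∫_Q |u − L_Q|² ≤ C ∫ |∇u|²`, the sum ranging over all dyadic cubes of `ℝⁿ`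
(of all scales).  (The sum of the nonnegative terms is bounded iff every finite partial
sum is.) -/
theorem cz_main_estimate_allScales (n : ℕ) :
    ∃ C : ℝ, 0 < C ∧
      ∀ (u : EuclideanSpace ℝ (Fin n) → ℝ),
        (∃ K : ℝ≥0, LipschitzWith K u) →
        HasCompactSupport u →
        ∀ L : (ℤ × (Fin n → ℤ)) → EuclideanSpace ℝ (Fin n) → ℝ,
          (∀ p, IsBestAffineApprox u (dyadicCubeZ n p) (L p)) →
          ∀ S : Finset (ℤ × (Fin n → ℤ)),
            ∑ p ∈ S, ((2 : ℝ) ^ p.1) ^ 2 * ∫ x in dyadicCubeZ n p, (u x - L p x) ^ 2 ∂volume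
              ≤ C * ∫ x, ‖fderiv ℝ u x‖ ^ 2 ∂volume := by
  obtain ⟨C, hC, H⟩ := exists_sum_sqAffineDefect_le (volume : Measure (EuclideanSpace ℝ (Fin n)))
    (fun i => EuclideanSpace.single i (1 : ℝ)) (fun i => by simp) Finset.univ
  refine ⟨4 ^ n * (4 * C) + 1, by positivity, ?_⟩
  rintro u ⟨K, hK⟩ hc L hL S
  have hu : MemLp u 2 volume := hK.continuous.memLp_of_hasCompactSupport hc
  set D : ℝ := ∫ x, ‖fderiv ℝ u x‖ ^ 2 with hD_def
  have hD : 0 ≤ D := integral_nonneg fun _ => sq_nonneg _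
  set A : ℤ → EuclideanSpace ℝ (Fin n) → ℝ := fun j t => sqAffineDefect volume u
    (fun i => EuclideanSpace.single i 1) Finset.univ (2 * 2 ^ (-j)) t with hA
  have hA0 : ∀ j t, 0 ≤ A j t := fun j t => integral_nonneg fun _ => sq_nonneg _
  have hsum : ∀ t ∈ unitBox n, ∀ J : Finset ℤ,
      ∑ j ∈ J, ((2 : ℝ) ^ j) ^ 2 * A j t ≤ 4 * C * D := by
    intro t ht
    refine sum_int_le_of_sum_range_le (fun j => mul_nonneg (by positivity) (hA0 j t)) fun N m => ?_
    have h1 := H u K hK hc (2 * 2 ^ (-N)) (by positivity) m t ht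
    have e : ∀ i : ℕ, (2 : ℝ) * 2 ^ (-(N - (i : ℤ))) = 2 * 2 ^ (-N) * 2 ^ i := fun i => by
      rw [neg_sub, sub_eq_neg_add, zpow_add₀ two_ne_zero, zpow_natCast, mul_assoc]
    have e2 : ∀ i : ℕ, ((2 : ℝ) ^ (N - (i : ℤ))) ^ 2 = 4 * ((2 * 2 ^ (-N) * 2 ^ i) ^ 2)⁻¹ :=
      fun i => by
        rw [zpow_sub₀ two_ne_zero, zpow_natCast, zpow_neg]
        field_simp
        norm_num
    simp only [hA, e, e2, mul_assoc (4 : ℝ)]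
    rw [← Finset.mul_sum]
    gcongr
  set E : ℤ × (Fin n → ℤ) → ℝ := fun p => ∫ x in dyadicCubeZ n p, (u x - L p x) ^ 2 with hE
  have hE0 : ∀ p, 0 ≤ E p := fun p => integral_nonneg fun _ => sq_nonneg _
  set J := S.image Prod.fst
  set F := S.image Prod.snd
  have hS : S ⊆ J ×ˢ F := fun p hp =>
    Finset.mem_product.2 ⟨Finset.mem_image_of_mem _ hp, Finset.mem_image_of_mem _ hp⟩
  have hle : ENNReal.ofReal (∑ j ∈ J, ∑ k ∈ F, ((2 : ℝ) ^ j) ^ 2 * E (j, k))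
      ≤ ENNReal.ofReal (4 ^ n * (4 * C * D)) := by
    have hmeas : ∀ j, Measurable fun t => ENNReal.ofReal (A j t) := fun j =>
      (measurable_sqAffineDefect hK.continuous _).ennreal_ofReal
    calc ENNReal.ofReal (∑ j ∈ J, ∑ k ∈ F, ((2 : ℝ) ^ j) ^ 2 * E (j, k))
        = ∑ j ∈ J, ENNReal.ofReal (((2 : ℝ) ^ j) ^ 2) * ∑ k ∈ F, ENNReal.ofReal (E (j, k)) := by
          rw [ENNReal.ofReal_sum_of_nonneg fun j _ => Finset.sum_nonneg fun k _ =>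
            mul_nonneg (by positivity) (hE0 _)]
          refine Finset.sum_congr rfl fun j _ => ?_
          rw [← Finset.mul_sum, ENNReal.ofReal_mul (by positivity),
            ENNReal.ofReal_sum_of_nonneg fun k _ => hE0 _]
      _ ≤ ∑ j ∈ J, ENNReal.ofReal (((2 : ℝ) ^ j) ^ 2) *
            (4 ^ n * ∫⁻ t in unitBox n, ENNReal.ofReal (A j t)) := by
          gcongr with j
          exact sum_ofReal_integral_dyadicCubeZ_le hK.continuous hu j F fun k => hL (j, k)
      _ = 4 ^ n * ∫⁻ t in unitBox n, ∑ j ∈ J, ENNReal.ofReal (((2 : ℝ) ^ j) ^ 2 * A j t) := by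
          rw [lintegral_finsetSum _ fun j _ => ?_, Finset.mul_sum]
          · refine Finset.sum_congr rfl fun j _ => ?_
            simp only [ENNReal.ofReal_mul (sq_nonneg ((2 : ℝ) ^ j))]
            rw [lintegral_const_mul _ (hmeas j), mul_left_comm]
          · exact ((measurable_sqAffineDefect hK.continuous _).const_mul _).ennreal_ofReal
      _ ≤ 4 ^ n * ∫⁻ _ in unitBox n, ENNReal.ofReal (4 * C * D) := by
          gcongr 4 ^ n * ?_
          refine setLIntegral_mono' isClosed_unitBox.measurableSet fun t ht => ?_
          rw [← ENNReal.ofReal_sum_of_nonneg fun j _ => mul_nonneg (by positivity) (hA0 j t)]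
          exact ENNReal.ofReal_le_ofReal (hsum t ht J)
      _ = ENNReal.ofReal (4 ^ n * (4 * C * D)) := by
          rw [setLIntegral_const, volume_unitBox, mul_one,
            ENNReal.ofReal_mul (p := 4 ^ n) (by positivity), ENNReal.ofReal_pow (by positivity),
            ENNReal.ofReal_ofNat]
  rw [ENNReal.ofReal_le_ofReal_iff (by positivity)] at hle
  refine (Finset.sum_le_sum_of_subset_of_nonneg hS fun p _ _ =>
    mul_nonneg (by positivity) (hE0 p)).trans ?_
  rw [Finset.sum_product]
  refine hle.trans ?_
  linarith
end
end

section
/- There is a constant c_n > 0 depending only on the dimension n such that for every Lipschitz function u : ℝⁿ → ℝ with compact support, ∫_{ℝⁿ} |∇u(x)|² dx = c_n ∫_{ξ ∈ ℝⁿ} ∫_{R > 0} ( R^{−(n+2)} ∫_{B(ξ,R)} |u(x) − L_{ξ,R}(x)|² dx ) (dR/R) dξ, where B(ξ,R) is the ball of center ξ and radius R and L_{ξ,R} is the affine function that best approximates u in L²(B(ξ,R)). -/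
open MeasureTheory NNReal Metric

noncomputable section

section Spectral
open Filter Topology
open scoped FourierTransform RealInnerProductSpace

/-- A form of Fatou's lemma for Bochner integrals of nonnegative functions. -/
lemma integrable_of_tendsto_integral {α : Type*} [MeasurableSpace α] {μ : Measure α}
    {F : ℕ → α → ℝ} {f : α → ℝ} {I : ℝ} (hF : ∀ k, Integrable (F k) μ) (hF0 : ∀ k x, 0 ≤ F k x)
    (hlim : ∀ x, Tendsto (fun k => F k x) atTop (𝓝 (f x)))
    (hint : Tendsto (fun k => ∫ x, F k x ∂μ) atTop (𝓝 I)) : Integrable f μ := by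
  have hf0 : ∀ x, 0 ≤ f x := fun x => ge_of_tendsto' (hlim x) fun k => hF0 k x
  refine ⟨aestronglyMeasurable_of_tendsto_ae atTop (fun k => (hF k).1)
    (Eventually.of_forall hlim), ?_⟩
  rw [hasFiniteIntegral_iff_ofReal (Eventually.of_forall hf0)]
  have h1 : ∀ x, ENNReal.ofReal (f x) = liminf (fun k => ENNReal.ofReal (F k x)) atTop := fun x =>
    ((ENNReal.continuous_ofReal.tendsto _).comp (hlim x)).liminf_eq.symm
  have h2 : liminf (fun k => ∫⁻ x, ENNReal.ofReal (F k x) ∂μ) atTop = ENNReal.ofReal I := by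
    refine Tendsto.liminf_eq ?_
    refine ((ENNReal.continuous_ofReal.tendsto _).comp hint).congr fun k => ?_
    exact ofReal_integral_eq_lintegral_ofReal (hF k) (Eventually.of_forall (hF0 k))
  calc ∫⁻ x, ENNReal.ofReal (f x) ∂μ
      = ∫⁻ x, liminf (fun k => ENNReal.ofReal (F k x)) atTop ∂μ := by simp_rw [h1]
    _ ≤ liminf (fun k => ∫⁻ x, ENNReal.ofReal (F k x) ∂μ) atTop :=
        lintegral_liminf_le' fun k => (hF k).1.aemeasurable.ennreal_ofReal
    _ < ⊤ := by rw [h2]; exact ENNReal.ofReal_lt_top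

variable {V : Type*} [NormedAddCommGroup V] [InnerProductSpace ℝ V]
  [MeasurableSpace V] [BorelSpace V] [FiniteDimensional ℝ V]

/-- An integrable function which is continuous at the origin and whose Fourier transform is
nonnegative has an integrable Fourier transform. -/
lemma integrable_fourier_of_nonneg {f : V → ℂ} (hf : Integrable f) (hc : ContinuousAt f 0)
    {w : V → ℝ} (hw : ∀ ζ, 0 ≤ w ζ) (hwc : Continuous w) (hfw : ∀ ζ, 𝓕 f ζ = w ζ) :
    Integrable w := by
  have hlim := Real.tendsto_integral_gaussian_smul' hf hc
  have hbd : ∀ ζ, ‖w ζ‖ ≤ ∫ x, ‖f x‖ := fun ζ => by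
    have := VectorFourier.norm_fourierIntegral_le_integral_norm Real.fourierChar volume
      (innerₗ V) f ζ
    have h2 : VectorFourier.fourierIntegral Real.fourierChar volume (innerₗ V) f ζ = w ζ := hfw ζ
    rw [h2] at this
    simpa using this
  have hgauss : ∀ c : ℝ, 0 < c → Integrable (fun ζ : V => Real.exp (-c⁻¹ * ‖ζ‖ ^ 2)) := by
    intro c hc
    have := (GaussianFourier.integrable_cexp_neg_mul_sq_norm_add (b := (c⁻¹ : ℝ)) (V := V)
      (by simpa using hc) 0 0).re
    refine this.congr (Eventually.of_forall fun ζ => ?_)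
    simp only [zero_mul, add_zero]
    rw [← Complex.ofReal_neg, ← Complex.ofReal_pow, ← Complex.ofReal_mul, ← Complex.ofReal_exp]
    rfl
  have key : ∀ c : ℝ, 0 < c → ((∫ ζ, Real.exp (-c⁻¹ * ‖ζ‖ ^ 2) * w ζ : ℝ) : ℂ) =
      ∫ x : V, ((Real.pi * c) ^ (Module.finrank ℝ V / 2 : ℂ) *
        Complex.exp (-Real.pi ^ 2 * c * ‖0 - x‖ ^ 2)) • f x := by
    intro c hc
    have J : Integrable (fun x : V => Complex.exp (-(c⁻¹ : ℝ) * ‖x‖ ^ 2)) := by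
      simpa using GaussianFourier.integrable_cexp_neg_mul_sq_norm_add (b := (c⁻¹ : ℝ)) (V := V)
        (by simpa using hc) 0 0
    have := VectorFourier.integral_fourierIntegral_smul_eq_flip (L := innerₗ V)
      Real.continuous_fourierChar continuous_inner J hf
    rw [flip_innerₗ] at this
    change ∫ ζ, 𝓕 (fun x : V => Complex.exp (-(c⁻¹ : ℝ) * ‖x‖ ^ 2)) ζ • f ζ =
      ∫ ζ, Complex.exp (-(c⁻¹ : ℝ) * ‖ζ‖ ^ 2) • 𝓕 f ζ at this
    rw [← integral_complex_ofReal]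
    refine Eq.trans ?_ (this.symm.trans ?_)
    · congr 1
      ext ζ
      rw [hfw]; simp
    · congr 1
      ext ζ
      rw [fourier_gaussian_innerProductSpace (by simpa using hc)]
      simp only [Complex.ofReal_inv, div_inv_eq_mul, zero_sub, norm_neg]
      congr 3
      ring
  refine integrable_of_tendsto_integral (F := fun (k : ℕ) ζ =>
    Real.exp (-((k : ℝ) + 1)⁻¹ * ‖ζ‖ ^ 2) * w ζ) (I := (f 0).re) ?_ ?_ ?_ ?_
  · intro k
    exact (hgauss ((k : ℝ) + 1) (by positivity)).mul_bdd hwc.aestronglyMeasurable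
      (Eventually.of_forall hbd)
  · intro k ζ
    exact mul_nonneg (Real.exp_nonneg _) (hw ζ)
  · intro ζ
    have h : Tendsto (fun k : ℕ => ((k : ℝ) + 1)⁻¹) atTop (𝓝 0) :=
      tendsto_inv_atTop_zero.comp (tendsto_natCast_atTop_atTop.atTop_add tendsto_const_nhds)
    have := ((Real.continuous_exp.tendsto _).comp ((h.neg).mul_const (‖ζ‖ ^ 2))).mul_const (w ζ)
    simpa using this
  · have h : Tendsto (fun k : ℕ => (k : ℝ) + 1) atTop atTop :=
      tendsto_natCast_atTop_atTop.atTop_add tendsto_const_nhds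
    have := (Complex.continuous_re.tendsto _).comp (hlim.comp h)
    refine this.congr fun k => ?_
    simp only [Function.comp]
    rw [← key _ (by positivity), Complex.ofReal_re]

/-- The autocorrelation of a continuous compactly supported function is the Fourier transform of
a nonnegative integrable function. -/
lemma exists_spectral_density {u : V → ℝ} (hu : Continuous u) (hs : HasCompactSupport u) :
    ∃ w : V → ℝ, (∀ ζ, 0 ≤ w ζ) ∧ Continuous w ∧ Integrable w ∧
      ∀ h, ∫ x, u x * u (x + h) = ∫ ζ, w ζ * Real.cos (2 * Real.pi * ⟪h, ζ⟫) := by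
  set U : V → ℂ := fun x => (u x : ℂ) with hU
  have hUc : Continuous U := by fun_prop
  have hUs : HasCompactSupport U := hs.comp_left (g := ((↑) : ℝ → ℂ)) (by simp)
  have hUi : Integrable U := hUc.integrable_of_hasCompactSupport hUs
  set U' : V → ℂ := fun x => U (-x) with hU'
  have hUc' : Continuous U' := hUc.comp continuous_neg
  have hUs' : HasCompactSupport U' := hUs.comp_homeomorph (Homeomorph.neg V)
  have hUi' : Integrable U' := hUc'.integrable_of_hasCompactSupport hUs'
  set f := convolution U U' (ContinuousLinearMap.mul ℂ ℂ) volume with hf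
  have hfc : Continuous f := hUs.continuous_convolution_left _ hUc hUi'.locallyIntegrable
  have hfs : HasCompactSupport f := hUs.convolution _ hUs'
  have hfi : Integrable f := hfc.integrable_of_hasCompactSupport hfs
  have hFc : Continuous (𝓕 U) :=
    VectorFourier.fourierIntegral_continuous Real.continuous_fourierChar continuous_inner hUi
  have hconj : ∀ ζ, 𝓕 U' ζ = (starRingEnd ℂ) (𝓕 U ζ) := by
    intro ζ
    rw [Real.fourier_eq', Real.fourier_eq', ← integral_conj, ← integral_neg_eq_self]
    congr 1
    ext x
    simp only [hU', hU, smul_eq_mul, neg_neg, map_mul, Complex.conj_ofReal, ← Complex.exp_conj,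
      Complex.conj_I, inner_neg_left]
    congr 2
    push_cast
    ring
  have hFf : ∀ ζ, 𝓕 f ζ = ((‖𝓕 U ζ‖ ^ 2 : ℝ) : ℂ) := by
    intro ζ
    rw [hf, Real.fourier_mul_convolution_eq hUi hUi', hconj, Complex.mul_conj,
      Complex.normSq_eq_norm_sq]
  have hwc : Continuous fun ζ => ‖𝓕 U ζ‖ ^ 2 := by fun_prop
  have hwi := integrable_fourier_of_nonneg hfi hfc.continuousAt
    (w := fun ζ => ‖𝓕 U ζ‖ ^ 2) (fun ζ => by positivity) hwc hFf
  refine ⟨fun ζ => ‖𝓕 U ζ‖ ^ 2, fun ζ => by positivity, hwc, hwi, fun h => ?_⟩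
  have hFfi : Integrable (𝓕 f) := by
    refine hwi.ofReal.congr (Eventually.of_forall fun ζ => (hFf ζ).symm)
  have hinv := congrFun (hfc.fourierInv_fourier_eq hfi hFfi) (-h)
  have hA : f (-h) = ((∫ x, u x * u (x + h) : ℝ) : ℂ) := by
    rw [hf, convolution_def, ← integral_complex_ofReal]
    congr 1
    ext x
    simp [hU', hU, add_comm]
  rw [hA, Real.fourierInv_eq'] at hinv
  have := congrArg Complex.re hinv
  rw [Complex.ofReal_re] at this
  rw [← this]
  have hint : Integrable fun ζ => Complex.exp (↑(2 * Real.pi * ⟪ζ, -h⟫) * Complex.I) • 𝓕 f ζ := by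
    refine hFfi.bdd_mul (c := 1) (by fun_prop) (Eventually.of_forall fun ζ => ?_)
    rw [Complex.norm_exp_ofReal_mul_I]
  refine (integral_re hint).symm.trans ?_
  congr 1
  ext ζ
  rw [hFf, smul_eq_mul, mul_comm, RCLike.re_eq_complex_re, Complex.re_ofReal_mul,
    Complex.exp_ofReal_mul_I_re, inner_neg_right, mul_neg, Real.cos_neg, real_inner_comm]

end Spectral

section Gradient
open Filter Topology
open scoped RealInnerProductSpace

variable {V : Type*} [NormedAddCommGroup V] [InnerProductSpace ℝ V]
  [MeasurableSpace V] [BorelSpace V] [FiniteDimensional ℝ V]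

lemma two_sub_two_mul_cos_eq (s t : ℝ) :
    2 - 2 * Real.cos (2 * Real.pi * (t * s)) =
      t ^ 2 * (2 * Real.pi * s * Real.sinc (Real.pi * t * s)) ^ 2 := by
  have h : ∀ x : ℝ, x * Real.sinc x = Real.sin x := fun x => by
    rcases eq_or_ne x 0 with rfl | hx
    · simp
    · rw [Real.sinc_of_ne_zero hx]; field_simp
  have h1 : t * (2 * Real.pi * s * Real.sinc (Real.pi * t * s)) =
      2 * Real.sin (Real.pi * t * s) := by rw [← h]; ring
  rw [← mul_pow, h1, show 2 * Real.pi * (t * s) = 2 * (Real.pi * t * s) by ring,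
    Real.cos_two_mul_eq_one_sub]
  ring

lemma integral_sq_lineDeriv_eq {u : V → ℝ} {K : ℝ≥0} (hu : LipschitzWith K u)
    (hs : HasCompactSupport u) {w : V → ℝ} (hw : ∀ ζ, 0 ≤ w ζ) (_hwc : Continuous w)
    (hwi : Integrable w)
    (hA : ∀ h, ∫ x, u x * u (x + h) = ∫ ζ, w ζ * Real.cos (2 * Real.pi * ⟪h, ζ⟫)) (e : V) :
    Integrable (fun ζ => w ζ * (2 * Real.pi * ⟪e, ζ⟫) ^ 2) ∧
      ∫ x, (fderiv ℝ u x e) ^ 2 = ∫ ζ, w ζ * (2 * Real.pi * ⟪e, ζ⟫) ^ 2 := by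
  have huc := hu.continuous
  have hui : ∀ h g : V, Integrable fun x => u (x + h) * u (x + g) := fun h g => by
    have h1 : HasCompactSupport fun x => u (x + h) := hs.comp_homeomorph (Homeomorph.addRight h)
    exact Continuous.integrable_of_hasCompactSupport (by fun_prop) h1.mul_right
  have hcosi : ∀ h : V, Integrable fun ζ => w ζ * Real.cos (2 * Real.pi * ⟪h, ζ⟫) := fun h =>
    hwi.mul_bdd (c := 1) (by fun_prop) (Eventually.of_forall fun ζ => by
      simpa using Real.abs_cos_le_one _)
  set t : ℕ → ℝ := fun k => ((k : ℝ) + 1)⁻¹ with ht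
  have ht0 : ∀ k, 0 < t k := fun k => by positivity
  have ht1 : ∀ k, t k ≤ 1 := fun k => inv_le_one_of_one_le₀ (by simp)
  have htlim : Tendsto t atTop (𝓝[>] 0) :=
    tendsto_inv_atTop_nhdsGT_zero.comp (tendsto_natCast_atTop_atTop.atTop_add tendsto_const_nhds)
  set Q : ℕ → V → ℝ := fun k x => ((t k)⁻¹ * (u (x + t k • e) - u x)) ^ 2 with hQ
  set W : ℕ → V → ℝ := fun k ζ =>
    w ζ * (2 * Real.pi * ⟪e, ζ⟫ * Real.sinc (Real.pi * t k * ⟪e, ζ⟫)) ^ 2 with hW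
  have hWeq : ∀ k ζ, W k ζ = ((t k)⁻¹) ^ 2 *
      (2 * w ζ - 2 * (w ζ * Real.cos (2 * Real.pi * ⟪t k • e, ζ⟫))) := by
    intro k ζ
    have := two_sub_two_mul_cos_eq ⟪e, ζ⟫ (t k)
    rw [real_inner_smul_left, show 2 * w ζ - 2 * (w ζ * Real.cos (2 * Real.pi * (t k * ⟪e, ζ⟫)))
      = w ζ * (2 - 2 * Real.cos (2 * Real.pi * (t k * ⟪e, ζ⟫))) by ring, this]
    have := (ht0 k).ne'
    simp only [hW]
    field_simp
  have hWi : ∀ k, Integrable (W k) := fun k => by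
    rw [funext (hWeq k)]
    exact ((hwi.const_mul 2).sub ((hcosi _).const_mul 2)).const_mul _
  have hQW : ∀ k, ∫ x, Q k x = ∫ ζ, W k ζ := by
    intro k
    have h1 : ∀ x, Q k x = ((t k)⁻¹) ^ 2 * ((u (x + t k • e) * u (x + t k • e) +
        u (x + 0) * u (x + 0)) - 2 * (u (x + 0) * u (x + t k • e))) := fun x => by
      simp only [hQ, add_zero]; ring
    have h2 : Integrable fun x => u (x + t k • e) * u (x + t k • e) + u (x + 0) * u (x + 0) :=
      (hui _ _).add (hui _ _)
    rw [integral_congr_ae (Eventually.of_forall h1), integral_congr_ae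
      (Eventually.of_forall (hWeq k)), integral_const_mul, integral_const_mul,
      integral_sub h2 ((hui _ _).const_mul 2),
      integral_add (hui _ _) (hui _ _), integral_sub (hwi.const_mul 2) ((hcosi _).const_mul 2),
      integral_const_mul, integral_const_mul, integral_const_mul,
      integral_add_right_eq_self (fun x => u x * u x)]
    have hA0 := hA 0
    simp only [add_zero, inner_zero_left, mul_zero, Real.cos_zero, mul_one] at hA0
    simp only [add_zero]
    rw [hA0, hA]
    ring
  have hQlim : Tendsto (fun k => ∫ x, Q k x) atTop (𝓝 (∫ x, (fderiv ℝ u x e) ^ 2)) := by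
    set S : Set V := cthickening ‖e‖ (tsupport u) with hS
    have hSc : IsCompact S := hs.isCompact.cthickening
    refine tendsto_integral_of_dominated_convergence
      (S.indicator fun _ => (K * ‖e‖) ^ 2) (fun k => ?_) ?_ (fun k => ?_) ?_
    · exact Continuous.aestronglyMeasurable (by fun_prop)
    · rw [integrable_indicator_iff hSc.measurableSet]
      exact integrableOn_const hSc.measure_lt_top.ne
    · refine Eventually.of_forall fun x => ?_
      by_cases hx : x ∈ S
      · rw [Set.indicator_of_mem hx, Real.norm_eq_abs, abs_of_nonneg (sq_nonneg _), hQ]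
        refine sq_le_sq' ?_ ?_ <;> [refine neg_le_of_abs_le ?_; refine le_of_abs_le ?_]
        all_goals
          have := hu.dist_le_mul (x + t k • e) x
          rw [Real.dist_eq, dist_eq_norm, add_sub_cancel_left, norm_smul, Real.norm_eq_abs,
            abs_of_pos (ht0 k)] at this
          rw [abs_mul, abs_of_pos (inv_pos.2 (ht0 k)), inv_mul_le_iff₀ (ht0 k)]
          linarith
      · have h1 : u x = 0 := image_eq_zero_of_notMem_tsupport fun h =>
          hx (self_subset_cthickening _ h)
        have h2 : u (x + t k • e) = 0 := image_eq_zero_of_notMem_tsupport fun h => hx <|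
          mem_cthickening_of_dist_le x _ _ _ h (by
            rw [dist_eq_norm, sub_add_cancel_left, norm_neg, norm_smul, Real.norm_eq_abs,
              abs_of_pos (ht0 k)]
            exact mul_le_of_le_one_left (norm_nonneg _) (ht1 k))
        rw [Set.indicator_of_notMem hx]
        simp [hQ, h1, h2]
    · filter_upwards [hu.ae_differentiableAt] with x hx
      have := (hx.hasFDerivAt.hasLineDerivAt e).tendsto_slope_zero_right.comp htlim
      exact this.pow 2
  have hWlim : ∀ ζ, Tendsto (fun k => W k ζ) atTop (𝓝 (w ζ * (2 * Real.pi * ⟪e, ζ⟫) ^ 2)) := by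
    intro ζ
    have h1 : Continuous fun s : ℝ =>
        w ζ * (2 * Real.pi * ⟪e, ζ⟫ * Real.sinc (Real.pi * s * ⟪e, ζ⟫)) ^ 2 := by
      have := Real.continuous_sinc
      fun_prop
    have := (h1.tendsto 0).comp (htlim.mono_right nhdsWithin_le_nhds)
    simpa [hW, Function.comp_def] using this
  have hWint : Tendsto (fun k => ∫ ζ, W k ζ) atTop (𝓝 (∫ x, (fderiv ℝ u x e) ^ 2)) :=
    hQlim.congr hQW
  have hi := integrable_of_tendsto_integral hWi
    (fun k ζ => mul_nonneg (hw ζ) (sq_nonneg _)) hWlim hWint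
  refine ⟨hi, tendsto_nhds_unique hWint ?_⟩
  refine tendsto_integral_of_dominated_convergence _ (fun k => (hWi k).1) hi (fun k => ?_)
    (Eventually.of_forall hWlim)
  refine Eventually.of_forall fun ζ => ?_
  rw [Real.norm_eq_abs, abs_of_nonneg (mul_nonneg (hw ζ) (sq_nonneg _))]
  refine mul_le_mul_of_nonneg_left ?_ (hw ζ)
  rw [mul_pow]
  refine mul_le_of_le_one_right (sq_nonneg _) ?_
  rw [sq_le_one_iff_abs_le_one]
  exact Real.abs_sinc_le_one _

lemma integral_sq_norm_fderiv_eq {u : V → ℝ} {K : ℝ≥0} (hu : LipschitzWith K u)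
    (hs : HasCompactSupport u) {w : V → ℝ} (hw : ∀ ζ, 0 ≤ w ζ) (hwc : Continuous w)
    (hwi : Integrable w)
    (hA : ∀ h, ∫ x, u x * u (x + h) = ∫ ζ, w ζ * Real.cos (2 * Real.pi * ⟪h, ζ⟫)) :
    Integrable (fun ζ => w ζ * ‖ζ‖ ^ 2) ∧
      ∫ x, ‖fderiv ℝ u x‖ ^ 2 = (2 * Real.pi) ^ 2 * ∫ ζ, w ζ * ‖ζ‖ ^ 2 := by
  set b := stdOrthonormalBasis ℝ V
  have hb := fun i => integral_sq_lineDeriv_eq hu hs hw hwc hwi hA (b i)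
  have hsum : ∀ ζ, ∑ i, w ζ * (2 * Real.pi * ⟪b i, ζ⟫) ^ 2 =
      (2 * Real.pi) ^ 2 * (w ζ * ‖ζ‖ ^ 2) := fun ζ => by
    rw [← b.sum_sq_inner_right ζ, Finset.mul_sum, Finset.mul_sum]
    exact Finset.sum_congr rfl fun i _ => by ring
  have hnorm : ∀ x, ‖fderiv ℝ u x‖ ^ 2 = ∑ i, (fderiv ℝ u x (b i)) ^ 2 := fun x => by
    rw [← (InnerProductSpace.toDual ℝ V).symm.norm_map, ← b.sum_sq_inner_left]
    simp [InnerProductSpace.toDual_symm_apply]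
  have hfi : ∀ i, Integrable fun x => (fderiv ℝ u x (b i)) ^ 2 := fun i => by
    have hS : IsCompact (tsupport u) := hs
    have hg : Integrable ((tsupport u).indicator fun _ => (K * ‖b i‖) ^ 2 : V → ℝ) := by
      rw [integrable_indicator_iff hS.measurableSet]
      exact integrableOn_const hS.measure_lt_top.ne
    refine hg.mono' ((measurable_fderiv_apply_const ℝ u (b i)).pow_const 2).aestronglyMeasurable
      (Eventually.of_forall fun x => ?_)
    by_cases hx : x ∈ tsupport u
    · rw [Set.indicator_of_mem hx, norm_pow]
      gcongr
      exact (ContinuousLinearMap.le_opNorm _ _).trans (by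
        gcongr; exact norm_fderiv_le_of_lipschitz ℝ hu)
    · rw [fderiv_of_notMem_tsupport ℝ hx, Set.indicator_of_notMem hx]
      simp
  have hi : Integrable fun ζ => (2 * Real.pi) ^ 2 * (w ζ * ‖ζ‖ ^ 2) := by
    simp_rw [← hsum]
    exact integrable_finsetSum _ fun i _ => (hb i).1
  constructor
  · refine (hi.const_mul ((2 * Real.pi) ^ 2)⁻¹).congr (Eventually.of_forall fun ζ => ?_)
    have := Real.pi_pos.ne'
    field_simp
  · rw [← integral_const_mul]
    simp_rw [hnorm, ← hsum]
    rw [integral_finsetSum _ fun i _ => hfi i, integral_finsetSum _ fun i _ => (hb i).1]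
    exact Finset.sum_congr rfl fun i _ => (hb i).2

end Gradient

section AffineDefect
variable {n : ℕ}

/-- The common second moment `∫ yᵢ²` of the coordinates over the unit ball of `ℝⁿ`. -/
def ballMoment (n : ℕ) : ℝ := (∫ y in ball (0 : EuclideanSpace ℝ (Fin n)) 1, ‖y‖ ^ 2) / n

/-- The squared `L²` distance on the unit ball from `f` to the affine functions, in closed form. -/
def affineDefect (f : EuclideanSpace ℝ (Fin n) → ℝ) : ℝ :=
  (∫ y in ball 0 1, f y ^ 2)
    - (volume.real (ball (0 : EuclideanSpace ℝ (Fin n)) 1))⁻¹ * (∫ y in ball 0 1, f y) ^ 2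
    - (ballMoment n)⁻¹ * ∑ i, (∫ y in ball 0 1, f y * y i) ^ 2

lemma Continuous.integrableOn_euclidean_ball {f : EuclideanSpace ℝ (Fin n) → ℝ}
    (hf : Continuous f) (ξ : EuclideanSpace ℝ (Fin n)) (R : ℝ) : IntegrableOn f (ball ξ R) :=
  (hf.continuousOn.integrableOn_compact (isCompact_closedBall ξ R)).mono_set ball_subset_closedBall

lemma setIntegral_unitBall_comp_isometry
    (T : EuclideanSpace ℝ (Fin n) ≃ₗᵢ[ℝ] EuclideanSpace ℝ (Fin n))
    {F : Type*} [NormedAddCommGroup F] [NormedSpace ℝ F] (f : EuclideanSpace ℝ (Fin n) → F) :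
    ∫ y in ball 0 1, f (T y) = ∫ y in ball 0 1, f y := by
  have := T.measurePreserving.setIntegral_preimage_emb T.toHomeomorph.measurableEmbedding f
    (ball 0 1)
  rwa [T.preimage_ball, map_zero] at this

lemma setIntegral_unitBall_coord (i : Fin n) :
    ∫ y in ball (0 : EuclideanSpace ℝ (Fin n)) 1, y i = 0 := by
  have := setIntegral_unitBall_comp_isometry (LinearIsometryEquiv.neg ℝ)
    fun y : EuclideanSpace ℝ (Fin n) => y i
  simp only [LinearIsometryEquiv.coe_neg, PiLp.neg_apply, integral_neg] at this
  linarith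

lemma setIntegral_unitBall_coord_mul_coord {i j : Fin n} (hij : i ≠ j) :
    ∫ y in ball (0 : EuclideanSpace ℝ (Fin n)) 1, y i * y j = 0 := by
  have := setIntegral_unitBall_comp_isometry
    (LinearIsometryEquiv.piLpCongrRight 2 fun k : Fin n =>
      if k = i then LinearIsometryEquiv.neg ℝ (E := ℝ) else LinearIsometryEquiv.refl ℝ ℝ)
    fun y : EuclideanSpace ℝ (Fin n) => y i * y j
  simp only [LinearIsometryEquiv.piLpCongrRight_apply, if_true, hij.symm, if_false,
    LinearIsometryEquiv.coe_neg, LinearIsometryEquiv.coe_refl, id, neg_mul, integral_neg] at this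
  linarith

lemma setIntegral_unitBall_coord_sq (i : Fin n) :
    ∫ y in ball (0 : EuclideanSpace ℝ (Fin n)) 1, y i ^ 2 = ballMoment n := by
  have h : ∀ j, ∫ y in ball (0 : EuclideanSpace ℝ (Fin n)) 1, y j ^ 2 =
      ∫ y in ball (0 : EuclideanSpace ℝ (Fin n)) 1, y i ^ 2 := fun j => by
    have := setIntegral_unitBall_comp_isometry
      (LinearIsometryEquiv.piLpCongrLeft 2 ℝ ℝ (Equiv.swap i j))
      fun y : EuclideanSpace ℝ (Fin n) => y i ^ 2
    simpa [LinearIsometryEquiv.piLpCongrLeft_apply, Equiv.piCongrLeft'] using this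
  have hn : (n : ℝ) ≠ 0 := by
    have := i.pos
    positivity
  rw [ballMoment, eq_div_iff hn]
  simp_rw [EuclideanSpace.norm_sq_eq, Real.norm_eq_abs, sq_abs]
  rw [integral_finsetSum _ fun j _ => Continuous.integrableOn_euclidean_ball (by fun_prop) _ _]
  simp [h, mul_comm]

lemma eqOn_unitBall_zero_of_setIntegral_eq_zero {f : EuclideanSpace ℝ (Fin n) → ℝ}
    (hf : Continuous f) (hf0 : ∀ y, 0 ≤ f y) (h : ∫ y in ball 0 1, f y = 0) :
    Set.EqOn f 0 (ball 0 1) := by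
  refine Measure.eqOn_open_of_ae_eq (μ := volume) ?_ isOpen_ball hf.continuousOn
    continuousOn_const
  exact (integral_eq_zero_iff_of_nonneg hf0 (hf.integrableOn_euclidean_ball _ _)).1 h

lemma ballMoment_pos (hn : 0 < n) : 0 < ballMoment n := by
  have hn' : (0 : ℝ) < n := by exact_mod_cast hn
  refine div_pos (lt_of_le_of_ne (integral_nonneg fun y => by positivity) fun h => ?_) hn'
  have h0 := eqOn_unitBall_zero_of_setIntegral_eq_zero (by fun_prop)
    (fun y : EuclideanSpace ℝ (Fin n) => by positivity) h.symm
  have h1 : ‖EuclideanSpace.single (⟨0, hn⟩ : Fin n) (1 / 2 : ℝ)‖ = 1 / 2 := by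
    simp
  have := h0 (x := EuclideanSpace.single ⟨0, hn⟩ (1 / 2)) (by
    rw [mem_ball_zero_iff, h1]; norm_num)
  simp only [h1] at this
  norm_num at this

lemma unitBall_volume_pos : 0 < volume.real (ball (0 : EuclideanSpace ℝ (Fin n)) 1) :=
  ENNReal.toReal_pos (measure_ball_pos _ _ one_pos).ne' measure_ball_lt_top.ne

lemma setIntegral_sq_sub_affine (hn : 0 < n) {f : EuclideanSpace ℝ (Fin n) → ℝ}
    (hf : Continuous f) (a : Fin n → ℝ) (b : ℝ) :
    ∫ y in ball 0 1, (f y - ((∑ i, a i * y i) + b)) ^ 2 = affineDefect f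
      + volume.real (ball (0 : EuclideanSpace ℝ (Fin n)) 1) *
        (b - (volume.real (ball (0 : EuclideanSpace ℝ (Fin n)) 1))⁻¹ * ∫ y in ball 0 1, f y) ^ 2
      + ballMoment n * ∑ i, (a i - (ballMoment n)⁻¹ * ∫ y in ball 0 1, f y * y i) ^ 2 := by
  have hI : ∀ g : EuclideanSpace ℝ (Fin n) → ℝ, Continuous g → IntegrableOn g (ball 0 1) :=
    fun g hg => hg.integrableOn_euclidean_ball _ _
  have hV := (unitBall_volume_pos (n := n)).ne'
  have hm := (ballMoment_pos hn).ne'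
  have h1 : ∫ y in ball (0 : EuclideanSpace ℝ (Fin n)) 1, (∑ i, a i * y i) = 0 := by
    rw [integral_finsetSum _ fun i _ => hI _ (by fun_prop)]
    simp_rw [integral_const_mul, setIntegral_unitBall_coord]
    simp
  have h2 : ∫ y in ball (0 : EuclideanSpace ℝ (Fin n)) 1, (∑ i, a i * y i) ^ 2 =
      ballMoment n * ∑ i, a i ^ 2 := by
    simp_rw [sq, Finset.sum_mul_sum]
    rw [integral_finsetSum _ fun i _ => hI _ (by fun_prop), Finset.mul_sum]
    refine Finset.sum_congr rfl fun i _ => ?_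
    rw [integral_finsetSum _ fun i _ => hI _ (by fun_prop), Finset.sum_eq_single i]
    · rw [← setIntegral_unitBall_coord_sq i, mul_comm, ← integral_const_mul]
      congr 1; ext y; ring
    · intro j _ hj
      have : ∀ y : EuclideanSpace ℝ (Fin n), a i * y i * (a j * y j) =
        a i * a j * (y i * y j) := fun y => by ring
      simp_rw [this, integral_const_mul, setIntegral_unitBall_coord_mul_coord hj.symm, mul_zero]
    · simp
  have h3 : ∫ y in ball (0 : EuclideanSpace ℝ (Fin n)) 1, f y * (∑ i, a i * y i) =
      ∑ i, a i * ∫ y in ball 0 1, f y * y i := by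
    simp_rw [Finset.mul_sum]
    rw [integral_finsetSum _ fun i _ => hI _ (by fun_prop)]
    refine Finset.sum_congr rfl fun i _ => ?_
    rw [← integral_const_mul]
    congr 1; ext y; ring
  have h4 : ∫ y in ball 0 1, (f y - ((∑ i, a i * y i) + b)) ^ 2 =
      (∫ y in ball 0 1, f y ^ 2) - 2 * b * (∫ y in ball 0 1, f y)
      - 2 * (∫ y in ball 0 1, f y * (∑ i, a i * y i))
      + (∫ y in ball (0 : EuclideanSpace ℝ (Fin n)) 1, (∑ i, a i * y i) ^ 2)
      + 2 * b * (∫ y in ball (0 : EuclideanSpace ℝ (Fin n)) 1, ∑ i, a i * y i)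
      + volume.real (ball (0 : EuclideanSpace ℝ (Fin n)) 1) * b ^ 2 := by
    have hc : ∫ y in ball (0 : EuclideanSpace ℝ (Fin n)) 1, b ^ 2 =
        volume.real (ball (0 : EuclideanSpace ℝ (Fin n)) 1) * b ^ 2 := by simp
    rw [← hc, ← integral_const_mul, ← integral_const_mul, ← integral_const_mul,
      ← integral_sub (hI _ (by fun_prop)) (hI _ (by fun_prop)),
      ← integral_sub (hI _ (by fun_prop)) (hI _ (by fun_prop)),
      ← integral_add (hI _ (by fun_prop)) (hI _ (by fun_prop)),
      ← integral_add (hI _ (by fun_prop)) (hI _ (by fun_prop)),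
      ← integral_add (hI _ (by fun_prop)) (hI _ (by fun_prop))]
    congr 1; ext y; ring
  have h5 : ∀ c : Fin n → ℝ, ballMoment n * ∑ i, (a i - (ballMoment n)⁻¹ * c i) ^ 2 =
      ballMoment n * ∑ i, a i ^ 2 - 2 * ∑ i, a i * c i + (ballMoment n)⁻¹ * ∑ i, c i ^ 2 := by
    intro c
    simp_rw [Finset.mul_sum]
    rw [← Finset.sum_sub_distrib, ← Finset.sum_add_distrib]
    refine Finset.sum_congr rfl fun i _ => ?_
    field_simp
    ring
  rw [h4, h1, h2, h3, h5, affineDefect]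
  field_simp
  ring

lemma affineDefect_le (hn : 0 < n) {f : EuclideanSpace ℝ (Fin n) → ℝ}
    (hf : Continuous f) (a : Fin n → ℝ) (b : ℝ) :
    affineDefect f ≤ ∫ y in ball 0 1, (f y - ((∑ i, a i * y i) + b)) ^ 2 := by
  rw [setIntegral_sq_sub_affine hn hf, add_assoc, le_add_iff_nonneg_right]
  have := ballMoment_pos hn
  have := unitBall_volume_pos (n := n)
  exact add_nonneg (by positivity) (mul_nonneg (by positivity)
    (Finset.sum_nonneg fun i _ => sq_nonneg _))

lemma exists_affineDefect_eq (hn : 0 < n) {f : EuclideanSpace ℝ (Fin n) → ℝ}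
    (hf : Continuous f) : ∃ (a : Fin n → ℝ) (b : ℝ),
      affineDefect f = ∫ y in ball 0 1, (f y - ((∑ i, a i * y i) + b)) ^ 2 := by
  refine ⟨fun i => (ballMoment n)⁻¹ * ∫ y in ball 0 1, f y * y i,
    (volume.real (ball (0 : EuclideanSpace ℝ (Fin n)) 1))⁻¹ * ∫ y in ball 0 1, f y, ?_⟩
  rw [setIntegral_sq_sub_affine hn hf]
  simp

lemma affineDefect_nonneg (hn : 0 < n) {f : EuclideanSpace ℝ (Fin n) → ℝ}
    (hf : Continuous f) : 0 ≤ affineDefect f := by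
  obtain ⟨a, b, h⟩ := exists_affineDefect_eq hn hf
  rw [h]
  exact integral_nonneg fun y => sq_nonneg _

lemma eqOn_affine_of_affineDefect_eq_zero (hn : 0 < n) {f : EuclideanSpace ℝ (Fin n) → ℝ}
    (hf : Continuous f) (h0 : affineDefect f = 0) : ∃ (a : Fin n → ℝ) (b : ℝ),
      ∀ y ∈ ball (0 : EuclideanSpace ℝ (Fin n)) 1, f y = (∑ i, a i * y i) + b := by
  obtain ⟨a, b, h⟩ := exists_affineDefect_eq hn hf
  refine ⟨a, b, fun y hy => ?_⟩
  have := eqOn_unitBall_zero_of_setIntegral_eq_zero (by fun_prop) (fun y => sq_nonneg _)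
    (h.symm.trans h0) hy
  simpa [sub_eq_zero] using this

lemma affineDefect_comp_isometry
    (T : EuclideanSpace ℝ (Fin n) ≃ₗᵢ[ℝ] EuclideanSpace ℝ (Fin n))
    {f : EuclideanSpace ℝ (Fin n) → ℝ} (hf : Continuous f) :
    affineDefect (fun y => f (T y)) = affineDefect f := by
  have hsum : ∀ g : EuclideanSpace ℝ (Fin n) → ℝ, Continuous g →
      ∑ i, (∫ y in ball 0 1, g y * y i) ^ 2 = ‖∫ y in ball 0 1, g y • y‖ ^ 2 := by
    intro g hg
    have hi : IntegrableOn (fun y => g y • y) (ball 0 1) :=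
      ((show Continuous fun y => g y • y by fun_prop).continuousOn.integrableOn_compact
        (isCompact_closedBall 0 1)).mono_set ball_subset_closedBall
    rw [EuclideanSpace.norm_sq_eq]
    refine Finset.sum_congr rfl fun i _ => ?_
    rw [Real.norm_eq_abs, sq_abs]
    have := (EuclideanSpace.proj (𝕜 := ℝ) i).integral_comp_comm hi
    simp only [PiLp.proj_apply, PiLp.smul_apply, smul_eq_mul] at this
    rw [this]
  rw [affineDefect, affineDefect, hsum _ hf, hsum _ (by fun_prop),
    setIntegral_unitBall_comp_isometry T f, setIntegral_unitBall_comp_isometry T (fun y => f y ^ 2)]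
  congr 3
  rw [← setIntegral_unitBall_comp_isometry T (fun y => f y • y)]
  simp_rw [← map_smul]
  have : ∫ y in ball 0 1, T (f (T y) • y) = T (∫ y in ball 0 1, f (T y) • y) :=
    T.toLinearIsometry.integral_comp_comm _
  rw [this, T.norm_map]

lemma setIntegral_ball_eq (φ : EuclideanSpace ℝ (Fin n) → ℝ) (ξ : EuclideanSpace ℝ (Fin n))
    {R : ℝ} (hR : 0 < R) :
    ∫ x in ball ξ R, φ x = R ^ n * ∫ y in ball 0 1, φ (ξ + R • y) := by
  have h1 := (measurePreserving_add_left volume ξ).setIntegral_preimage_emb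
    (measurableEmbedding_addLeft ξ) φ (ball ξ R)
  have h2 := Measure.setIntegral_comp_smul_of_pos volume (fun y => φ (ξ + y))
    (ball (0 : EuclideanSpace ℝ (Fin n)) 1) hR
  rw [smul_unitBall_of_pos hR] at h2
  rw [h2, ← h1, preimage_add_ball, sub_self, finrank_euclideanSpace, Fintype.card_fin, smul_eq_mul]
  field_simp

lemma IsBestAffineApprox.setIntegral_sq_sub (hn : 0 < n) {u : EuclideanSpace ℝ (Fin n) → ℝ}
    (hu : Continuous u) {ξ : EuclideanSpace ℝ (Fin n)} {R : ℝ} (hR : 0 < R)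
    {L : EuclideanSpace ℝ (Fin n) → ℝ} (hL : IsBestAffineApprox u (ball ξ R) L) :
    ∫ x in ball ξ R, (u x - L x) ^ 2 = R ^ n * affineDefect fun y => u (ξ + R • y) := by
  have hc : Continuous fun y => u (ξ + R • y) := by fun_prop
  obtain ⟨⟨a, b, rfl⟩, hbest⟩ := hL
  apply le_antisymm
  · obtain ⟨A, B, hAB⟩ := exists_affineDefect_eq hn hc
    refine (hbest _ ⟨fun i => A i / R, B - ∑ i, A i / R * ξ i, rfl⟩).trans_eq ?_
    rw [setIntegral_ball_eq _ _ hR, hAB]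
    congr 2; ext y
    simp only [PiLp.add_apply, PiLp.smul_apply, smul_eq_mul, mul_add, Finset.sum_add_distrib]
    have : ∀ i, A i / R * (R * y i) = A i * y i := fun i => by field_simp
    simp_rw [this]
    ring
  · rw [setIntegral_ball_eq _ _ hR]
    refine mul_le_mul_of_nonneg_left ?_ (by positivity)
    refine (affineDefect_le hn hc (fun i => a i * R) (b + ∑ i, a i * ξ i)).trans_eq ?_
    congr 1; ext y
    simp only [PiLp.add_apply, PiLp.smul_apply, smul_eq_mul, mul_add, Finset.sum_add_distrib]
    simp_rw [mul_assoc]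
    ring

end AffineDefect

section WaveDefect
open scoped RealInnerProductSpace
variable {n : ℕ}

/-- The squared `L²` distance on the unit ball from the plane wave of frequency `η` to the (complex)
affine functions. -/
def waveDefect (η : EuclideanSpace ℝ (Fin n)) : ℝ :=
  affineDefect (fun y => Real.cos (2 * Real.pi * ⟪y, η⟫)) +
    affineDefect (fun y => Real.sin (2 * Real.pi * ⟪y, η⟫))

lemma measurable_affineDefect {X : Type*} [TopologicalSpace X] [SecondCountableTopology X]
    [MeasurableSpace X] [OpensMeasurableSpace X] {Φ : X → EuclideanSpace ℝ (Fin n) → ℝ}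
    (hΦ : Continuous fun p : X × EuclideanSpace ℝ (Fin n) => Φ p.1 p.2) :
    Measurable fun x => affineDefect (Φ x) := by
  have h : ∀ g : X × EuclideanSpace ℝ (Fin n) → ℝ, Continuous g →
      Measurable fun x => ∫ y in ball 0 1, g (x, y) := fun g hg =>
    (hg.stronglyMeasurable.integral_prod_right' (ν := volume.restrict (ball 0 1))).measurable
  unfold affineDefect
  refine ((h (fun p => Φ p.1 p.2 ^ 2) (by fun_prop)).sub
    (((h (fun p => Φ p.1 p.2) (by fun_prop)).pow_const 2).const_mul _)).sub
    (Measurable.const_mul (Finset.measurable_sum _ fun i _ =>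
      (h (fun p => Φ p.1 p.2 * p.2 i) (by fun_prop)).pow_const 2) _)

lemma measurable_waveDefect : Measurable (waveDefect (n := n)) := by
  unfold waveDefect
  exact (measurable_affineDefect (by fun_prop)).add (measurable_affineDefect (by fun_prop))

lemma waveDefect_nonneg (hn : 0 < n) (η : EuclideanSpace ℝ (Fin n)) : 0 ≤ waveDefect η :=
  add_nonneg (affineDefect_nonneg hn (by fun_prop)) (affineDefect_nonneg hn (by fun_prop))

lemma waveDefect_pos (hn : 0 < n) {η : EuclideanSpace ℝ (Fin n)} (hη : η ≠ 0) :
    0 < waveDefect η := by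
  refine lt_of_le_of_ne (waveDefect_nonneg hn η) fun h => ?_
  have hcos := affineDefect_nonneg hn
    (f := fun y : EuclideanSpace ℝ (Fin n) => Real.cos (2 * Real.pi * ⟪y, η⟫)) (by fun_prop)
  have hsin := affineDefect_nonneg hn
    (f := fun y : EuclideanSpace ℝ (Fin n) => Real.sin (2 * Real.pi * ⟪y, η⟫)) (by fun_prop)
  obtain ⟨a, b, hab⟩ := eqOn_affine_of_affineDefect_eq_zero hn
    (f := fun y : EuclideanSpace ℝ (Fin n) => Real.cos (2 * Real.pi * ⟪y, η⟫)) (by fun_prop)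
    (by rw [waveDefect] at h; linarith)
  have hη0 : 0 < ‖η‖ := norm_pos_iff.2 hη
  set τ : ℝ := (1 + ‖η‖ + ‖η‖ ^ 2)⁻¹ with hτ
  have hτ0 : 0 < τ := by positivity
  have hτm : τ * (1 + ‖η‖ + ‖η‖ ^ 2) = 1 := inv_mul_cancel₀ (by positivity)
  have hball : τ • η ∈ ball (0 : EuclideanSpace ℝ (Fin n)) 1 := by
    rw [mem_ball_zero_iff, norm_smul, Real.norm_eq_abs, abs_of_pos hτ0]
    nlinarith [mul_pos hτ0 hη0, mul_pos hτ0 (pow_pos hη0 2)]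
  have h0 := hab 0 (by simp)
  have h1 := hab _ hball
  have h2 := hab (-(τ • η)) (by simpa using hball)
  simp only [inner_zero_left, mul_zero, Real.cos_zero, PiLp.zero_apply, Finset.sum_const_zero,
    zero_add] at h0
  simp only [inner_neg_left, mul_neg, Real.cos_neg, PiLp.neg_apply, Finset.sum_neg_distrib] at h2
  have hc : Real.cos (2 * Real.pi * ⟪τ • η, η⟫) = 1 := by linarith
  rw [real_inner_smul_left, real_inner_self_eq_norm_sq] at hc
  have hlt : τ * ‖η‖ ^ 2 < 1 := by nlinarith [mul_pos hτ0 hη0]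
  have hpos : 0 < τ * ‖η‖ ^ 2 := by positivity
  rw [Real.cos_eq_one_iff_of_lt_of_lt (by nlinarith [Real.pi_pos]) (by nlinarith [Real.pi_pos])]
    at hc
  have : 0 < 2 * Real.pi * (τ * ‖η‖ ^ 2) := by positivity
  linarith

lemma waveDefect_congr_norm {η η' : EuclideanSpace ℝ (Fin n)} (h : ‖η‖ = ‖η'‖) :
    waveDefect η = waveDefect η' := by
  set T := (ℝ ∙ (η - η'))ᗮ.reflection with hT
  have hTη : T η = η' := Submodule.reflection_sub h
  have hin : ∀ y, ⟪y, η⟫ = ⟪T y, η'⟫ := fun y => by rw [← hTη, T.inner_map_map]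
  unfold waveDefect
  simp_rw [hin]
  rw [affineDefect_comp_isometry T (f := fun y => Real.cos (2 * Real.pi * ⟪y, η'⟫)) (by fun_prop),
    affineDefect_comp_isometry T (f := fun y => Real.sin (2 * Real.pi * ⟪y, η'⟫)) (by fun_prop)]

lemma waveDefect_le (hn : 0 < n) (η : EuclideanSpace ℝ (Fin n)) :
    waveDefect η ≤ volume.real (ball (0 : EuclideanSpace ℝ (Fin n)) 1) := by
  have h1 := affineDefect_le hn
    (f := fun y : EuclideanSpace ℝ (Fin n) => Real.cos (2 * Real.pi * ⟪y, η⟫)) (by fun_prop) 0 0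
  have h2 := affineDefect_le hn
    (f := fun y : EuclideanSpace ℝ (Fin n) => Real.sin (2 * Real.pi * ⟪y, η⟫)) (by fun_prop) 0 0
  refine (add_le_add h1 h2).trans_eq ?_
  rw [← integral_add (Continuous.integrableOn_euclidean_ball (by fun_prop) _ _)
    (Continuous.integrableOn_euclidean_ball (by fun_prop) _ _)]
  simp

lemma abs_sin_sub_self_le (t : ℝ) : |Real.sin t - t| ≤ 2 * t ^ 2 := by
  wlog ht : 0 ≤ t generalizing t
  · have := this (-t) (by linarith)
    rwa [Real.sin_neg, neg_sub_neg, abs_sub_comm, neg_sq] at this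
  rw [abs_sub_comm, abs_of_nonneg (sub_nonneg.2 (Real.sin_le ht))]
  rcases le_or_gt t 1 with h1 | h1
  · rcases ht.eq_or_lt with rfl | h0
    · simp
    · have := Real.sin_gt_sub_cube h0
      nlinarith [mul_nonneg (sq_nonneg t) (sub_nonneg.2 h1), sq_nonneg t]
  · nlinarith [Real.neg_one_le_sin t]

lemma waveDefect_le_pow (hn : 0 < n) (η : EuclideanSpace ℝ (Fin n)) :
    waveDefect η ≤
      5 * (2 * Real.pi * ‖η‖) ^ 4 * volume.real (ball (0 : EuclideanSpace ℝ (Fin n)) 1) := by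
  have h1 := affineDefect_le hn
    (f := fun y : EuclideanSpace ℝ (Fin n) => Real.cos (2 * Real.pi * ⟪y, η⟫)) (by fun_prop) 0 1
  have h2 := affineDefect_le hn
    (f := fun y : EuclideanSpace ℝ (Fin n) => Real.sin (2 * Real.pi * ⟪y, η⟫)) (by fun_prop)
    (fun i => 2 * Real.pi * η i) 0
  refine (add_le_add h1 h2).trans ?_
  rw [← integral_add (Continuous.integrableOn_euclidean_ball (by fun_prop) _ _)
    (Continuous.integrableOn_euclidean_ball (by fun_prop) _ _)]
  have hc : ∫ y in ball (0 : EuclideanSpace ℝ (Fin n)) 1, 5 * (2 * Real.pi * ‖η‖) ^ 4 =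
      5 * (2 * Real.pi * ‖η‖) ^ 4 * volume.real (ball (0 : EuclideanSpace ℝ (Fin n)) 1) := by
    simp [mul_comm]
  rw [← hc]
  refine setIntegral_mono_on (Continuous.integrableOn_euclidean_ball (by fun_prop) _ _)
    (Continuous.integrableOn_euclidean_ball (by fun_prop) _ _) measurableSet_ball fun y hy => ?_
  have hsum : ∑ i, 2 * Real.pi * η i * y i = 2 * Real.pi * ⟪y, η⟫ := by
    simp [PiLp.inner_apply, Finset.mul_sum, mul_assoc]
  simp only [hsum, Pi.zero_apply, zero_mul, Finset.sum_const_zero, zero_add, add_zero]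
  set t := 2 * Real.pi * ⟪y, η⟫ with ht
  have htle : |t| ≤ 2 * Real.pi * ‖η‖ := by
    rw [ht, abs_mul, abs_of_pos Real.two_pi_pos]
    refine mul_le_mul_of_nonneg_left ?_ Real.two_pi_pos.le
    refine (abs_real_inner_le_norm _ _).trans (mul_le_of_le_one_left (norm_nonneg _) ?_)
    exact (mem_ball_zero_iff.1 hy).le
  have hs : (Real.sin t - t) ^ 2 ≤ 4 * t ^ 4 := by
    have := pow_le_pow_left₀ (abs_nonneg _) (abs_sin_sub_self_le t) 2
    rw [sq_abs] at this
    linarith [show (2 * t ^ 2) ^ 2 = 4 * t ^ 4 by ring]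
  have hcos : (Real.cos t - 1) ^ 2 ≤ t ^ 4 := by
    have h3 := Real.one_sub_sq_div_two_le_cos (x := t)
    have h4 := Real.cos_le_one t
    nlinarith [sq_nonneg t]
  have h4 : t ^ 4 ≤ (2 * Real.pi * ‖η‖) ^ 4 := by
    have := pow_le_pow_left₀ (abs_nonneg _) htle 4
    rwa [show |t| ^ 4 = t ^ 4 from Even.pow_abs (by decide) t] at this
  linarith

/-- The constant `∫₀^∞ Φ(s e) s⁻³ ds`, with `Φ` the wave defect and `e` a unit vector. -/
def waveConst (e : EuclideanSpace ℝ (Fin n)) : ℝ :=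
  ∫ s in Set.Ioi (0 : ℝ), waveDefect (s • e) / s ^ 3

lemma integrableOn_waveDefect (hn : 0 < n) {e : EuclideanSpace ℝ (Fin n)} (he : ‖e‖ = 1) :
    IntegrableOn (fun s : ℝ => waveDefect (s • e) / s ^ 3) (Set.Ioi 0) := by
  set v := volume.real (ball (0 : EuclideanSpace ℝ (Fin n)) 1) with hv
  have hm : Measurable fun s : ℝ => waveDefect (s • e) / s ^ 3 :=
    (measurable_waveDefect.comp (by fun_prop)).div (by fun_prop)
  rw [← Set.Ioc_union_Ioi_eq_Ioi zero_le_one]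
  refine IntegrableOn.union ?_ ?_
  · refine Measure.integrableOn_of_bounded (M := 5 * (2 * Real.pi) ^ 4 * v) (by simp)
      hm.aestronglyMeasurable ?_
    refine (ae_restrict_iff' measurableSet_Ioc).2 (Filter.Eventually.of_forall fun s hs => ?_)
    have h0 : 0 < s := hs.1
    have := waveDefect_le_pow hn (s • e)
    rw [norm_smul, he, mul_one, Real.norm_eq_abs, abs_of_pos h0] at this
    rw [Real.norm_eq_abs, abs_of_nonneg (div_nonneg (waveDefect_nonneg hn _) (by positivity)),
      div_le_iff₀ (by positivity)]
    refine this.trans ?_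
    have h4 : s ^ 4 ≤ s ^ 3 := pow_le_pow_of_le_one h0.le hs.2 (by norm_num)
    have hv0 : 0 ≤ v := measureReal_nonneg
    calc 5 * (2 * Real.pi * s) ^ 4 * v = 5 * (2 * Real.pi) ^ 4 * v * s ^ 4 := by ring
      _ ≤ 5 * (2 * Real.pi) ^ 4 * v * s ^ 3 := by gcongr
  · have hr := (integrableOn_Ioi_rpow_of_lt (a := -3) (by norm_num) one_pos).const_mul v
    refine hr.mono' hm.aestronglyMeasurable ?_
    refine (ae_restrict_iff' measurableSet_Ioi).2 (Filter.Eventually.of_forall fun s hs => ?_)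
    have h0 : 0 < s := one_pos.trans hs
    rw [Real.norm_eq_abs, abs_of_nonneg (div_nonneg (waveDefect_nonneg hn _) (by positivity)),
      Real.rpow_neg h0.le, ← div_eq_mul_inv]
    norm_cast
    gcongr
    exact waveDefect_le hn _

lemma waveConst_pos (hn : 0 < n) {e : EuclideanSpace ℝ (Fin n)} (he : ‖e‖ = 1) :
    0 < waveConst e := by
  have hpos : ∀ s ∈ Set.Ioi (0 : ℝ), 0 < waveDefect (s • e) / s ^ 3 := fun s hs => by
    have h0 : 0 < s := hs
    have : s • e ≠ 0 := smul_ne_zero h0.ne' (norm_ne_zero_iff.1 (by simp [he]))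
    exact div_pos (waveDefect_pos hn this) (by positivity)
  rw [waveConst, setIntegral_pos_iff_support_of_nonneg_ae
    ((ae_restrict_iff' measurableSet_Ioi).2 (Filter.Eventually.of_forall fun s hs => (hpos s hs).le))
    (integrableOn_waveDefect hn he)]
  have hsub : Set.Ioi (0 : ℝ) ⊆ Function.support fun s => waveDefect (s • e) / s ^ 3 :=
    fun s hs => (hpos s hs).ne'
  rw [Set.inter_eq_right.2 hsub]
  simp

lemma waveDefect_smul_div {e : EuclideanSpace ℝ (Fin n)} (he : ‖e‖ = 1)
    {ζ : EuclideanSpace ℝ (Fin n)} (hζ : ζ ≠ 0) (R : ℝ) :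
    waveDefect (R • ζ) / R ^ 3 =
      ‖ζ‖ ^ 3 * (waveDefect ((R * ‖ζ‖) • e) / (R * ‖ζ‖) ^ 3) := by
  have : ‖ζ‖ ≠ 0 := norm_ne_zero_iff.2 hζ
  rw [waveDefect_congr_norm (η := R • ζ) (η' := (R * ‖ζ‖) • e) (by simp [norm_smul, he]), mul_pow,
    mul_comm (R ^ 3), ← div_div, mul_div_assoc', mul_div_cancel₀ _ (pow_ne_zero 3 this)]

lemma waveDefect_zero (hn : 0 < n) : waveDefect (0 : EuclideanSpace ℝ (Fin n)) = 0 :=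
  le_antisymm (by simpa using waveDefect_le_pow hn (0 : EuclideanSpace ℝ (Fin n)))
    (waveDefect_nonneg hn _)

lemma integrableOn_waveDefect_smul (hn : 0 < n) {e : EuclideanSpace ℝ (Fin n)} (he : ‖e‖ = 1)
    (ζ : EuclideanSpace ℝ (Fin n)) :
    IntegrableOn (fun R : ℝ => waveDefect (R • ζ) / R ^ 3) (Set.Ioi 0) := by
  rcases eq_or_ne ζ 0 with rfl | hζ
  · simp [waveDefect_zero hn]
  simp_rw [waveDefect_smul_div he hζ]
  refine Integrable.const_mul ?_ _
  have h := (integrableOn_Ioi_comp_mul_right_iff (fun s : ℝ => waveDefect (s • e) / s ^ 3) 0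
    (norm_pos_iff.2 hζ)).2 (by simpa using integrableOn_waveDefect hn he)
  exact h

lemma integral_waveDefect_smul (hn : 0 < n) {e : EuclideanSpace ℝ (Fin n)} (he : ‖e‖ = 1)
    (ζ : EuclideanSpace ℝ (Fin n)) :
    ∫ R in Set.Ioi (0 : ℝ), waveDefect (R • ζ) / R ^ 3 = waveConst e * ‖ζ‖ ^ 2 := by
  rcases eq_or_ne ζ 0 with rfl | hζ
  · simp [waveDefect_zero hn]
  have hζ' := norm_pos_iff.2 hζ
  simp_rw [waveDefect_smul_div he hζ]
  rw [integral_const_mul, integral_comp_mul_right_Ioi (fun s : ℝ => waveDefect (s • e) / s ^ 3) 0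
    hζ', zero_mul, smul_eq_mul, waveConst]
  field_simp

end WaveDefect

section Assembly
open scoped RealInnerProductSpace
variable {n : ℕ}

lemma integral_sq_setIntegral_translate {u : EuclideanSpace ℝ (Fin n) → ℝ} (hu : Continuous u)
    (hs : HasCompactSupport u) {w : EuclideanSpace ℝ (Fin n) → ℝ} (hwi : Integrable w)
    (hA : ∀ h, ∫ x, u x * u (x + h) = ∫ ζ, w ζ * Real.cos (2 * Real.pi * ⟪h, ζ⟫)) (R : ℝ)
    {g : EuclideanSpace ℝ (Fin n) → ℝ} (hg : Continuous g) :
    Integrable (fun ξ => (∫ y in ball 0 1, u (ξ + R • y) * g y) ^ 2) ∧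
    Integrable (fun ζ => w ζ * ((∫ y in ball 0 1, Real.cos (2 * Real.pi * ⟪y, R • ζ⟫) * g y) ^ 2 +
        (∫ y in ball 0 1, Real.sin (2 * Real.pi * ⟪y, R • ζ⟫) * g y) ^ 2)) ∧
    ∫ ξ, (∫ y in ball 0 1, u (ξ + R • y) * g y) ^ 2 =
      ∫ ζ, w ζ * ((∫ y in ball 0 1, Real.cos (2 * Real.pi * ⟪y, R • ζ⟫) * g y) ^ 2 +
        (∫ y in ball 0 1, Real.sin (2 * Real.pi * ⟪y, R • ζ⟫) * g y) ^ 2) := by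
  set ν := (volume : Measure (EuclideanSpace ℝ (Fin n))).restrict (ball 0 1) with hν
  have hgi : ∀ f : EuclideanSpace ℝ (Fin n) → ℝ, Continuous f → Integrable f ν := fun f hf =>
    hf.integrableOn_euclidean_ball 0 1
  have hui : Integrable u := hu.integrable_of_hasCompactSupport hs
  obtain ⟨C, hC⟩ := hs.exists_bound_of_continuous hu
  set F : EuclideanSpace ℝ (Fin n) →
      EuclideanSpace ℝ (Fin n) × EuclideanSpace ℝ (Fin n) → ℝ := fun ξ p =>
    (u (ξ + R • p.1) * g p.1) * (u (ξ + R • p.2) * g p.2) with hF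
  set H : EuclideanSpace ℝ (Fin n) →
      EuclideanSpace ℝ (Fin n) × EuclideanSpace ℝ (Fin n) → ℝ := fun ζ p =>
    w ζ * (g p.1 * g p.2) * Real.cos (2 * Real.pi * ⟪R • p.2 - R • p.1, ζ⟫) with hH
  have hgg : Integrable (fun p : EuclideanSpace ℝ (Fin n) × EuclideanSpace ℝ (Fin n) =>
      g p.1 * g p.2) (ν.prod ν) := (hgi g hg).mul_prod (hgi g hg)
  have hHi : Integrable (Function.uncurry H) (volume.prod (ν.prod ν)) := by
    refine (hwi.mul_prod hgg).mul_bdd (c := 1) ?_ (Filter.Eventually.of_forall fun p => ?_)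
    · exact Continuous.aestronglyMeasurable (by fun_prop)
    · simpa using Real.abs_cos_le_one _
  have hFm : AEStronglyMeasurable (Function.uncurry F) (volume.prod (ν.prod ν)) :=
    Continuous.aestronglyMeasurable (by unfold Function.uncurry; fun_prop)
  have hFsec : ∀ p, Integrable fun ξ => F ξ p := fun p => by
    have h1 : Integrable fun ξ => (u (ξ + R • p.1) * g p.1) :=
      (hui.comp_add_right (R • p.1)).mul_const _
    refine h1.mul_bdd (c := C * ‖g p.2‖) (by fun_prop)
      (Filter.Eventually.of_forall fun ξ => ?_)
    rw [norm_mul]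
    gcongr
    exact hC _
  have hFi : Integrable (Function.uncurry F) (volume.prod (ν.prod ν)) := by
    rw [integrable_prod_iff' hFm]
    refine ⟨Filter.Eventually.of_forall hFsec, ?_⟩
    refine Integrable.mono' (hgg.norm.const_mul (C * ∫ ξ, ‖u ξ‖))
      hFm.norm.prod_swap.integral_prod_right' (Filter.Eventually.of_forall fun p => ?_)
    rw [Real.norm_eq_abs, abs_of_nonneg (integral_nonneg fun _ => norm_nonneg _)]
    have h2 : ∫ ξ, C * ‖g p.1 * g p.2‖ * ‖u (ξ + R • p.1)‖ =
        (C * ∫ ξ, ‖u ξ‖) * ‖g p.1 * g p.2‖ := by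
      rw [integral_const_mul, integral_add_right_eq_self (fun ξ => ‖u ξ‖)]
      ring
    rw [← h2]
    refine integral_mono (hFsec p).norm ((hui.comp_add_right (R • p.1)).norm.const_mul _)
      fun ξ => ?_
    simp only [Function.uncurry, hF, norm_mul]
    have := hC (ξ + R • p.2)
    calc ‖u (ξ + R • p.1)‖ * ‖g p.1‖ * (‖u (ξ + R • p.2)‖ * ‖g p.2‖)
        ≤ ‖u (ξ + R • p.1)‖ * ‖g p.1‖ * (C * ‖g p.2‖) := by gcongr
      _ = _ := by ring
  have hFint : ∀ ξ, ∫ p, F ξ p ∂(ν.prod ν) = (∫ y, u (ξ + R • y) * g y ∂ν) ^ 2 := fun ξ => by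
    rw [sq]
    exact integral_prod_mul (fun y => u (ξ + R • y) * g y) (fun y => u (ξ + R • y) * g y)
  have hHint : ∀ ζ, ∫ p, H ζ p ∂(ν.prod ν) =
      w ζ * ((∫ y, Real.cos (2 * Real.pi * ⟪y, R • ζ⟫) * g y ∂ν) ^ 2 +
        (∫ y, Real.sin (2 * Real.pi * ⟪y, R • ζ⟫) * g y ∂ν) ^ 2) := fun ζ => by
    have hc := hgi (fun y => Real.cos (2 * Real.pi * ⟪y, R • ζ⟫) * g y) (by fun_prop)
    have hs := hgi (fun y => Real.sin (2 * Real.pi * ⟪y, R • ζ⟫) * g y) (by fun_prop)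
    rw [sq, sq, ← integral_prod_mul, ← integral_prod_mul,
      ← integral_add (hc.mul_prod hc) (hs.mul_prod hs), ← integral_const_mul]
    congr 1; ext p
    simp only [hH, inner_sub_left, real_inner_smul_left, real_inner_smul_right, mul_sub,
      Real.cos_sub]
    ring
  have hswap : ∀ p, ∫ ξ, F ξ p = ∫ ζ, H ζ p := fun p => by
    have h1 := integral_add_right_eq_self (μ := (volume : Measure (EuclideanSpace ℝ (Fin n))))
      (fun x => u x * u (x + (R • p.2 - R • p.1))) (R • p.1)
    have h2 : ∀ ξ, F ξ p = (g p.1 * g p.2) *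
        (u (ξ + R • p.1) * u (ξ + R • p.1 + (R • p.2 - R • p.1))) := fun ξ => by
      simp only [hF]
      rw [show ξ + R • p.1 + (R • p.2 - R • p.1) = ξ + R • p.2 by abel]
      ring
    simp_rw [h2]
    rw [integral_const_mul, h1, hA, ← integral_const_mul]
    congr 1; ext ζ
    simp only [hH]; ring
  refine ⟨?_, ?_, ?_⟩
  · simp_rw [← hFint]; exact hFi.integral_prod_left
  · simp_rw [← hHint]; exact hHi.integral_prod_left
  · simp_rw [← hFint, ← hHint]
    rw [integral_integral_swap hFi, integral_integral_swap hHi]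
    simp_rw [hswap]

lemma integral_setIntegral_sq_translate {u : EuclideanSpace ℝ (Fin n) → ℝ} (hu : Continuous u)
    (hs : HasCompactSupport u) (R : ℝ) :
    Integrable (fun ξ => ∫ y in ball 0 1, u (ξ + R • y) ^ 2) ∧
    ∫ ξ, (∫ y in ball 0 1, u (ξ + R • y) ^ 2) =
      volume.real (ball (0 : EuclideanSpace ℝ (Fin n)) 1) * ∫ x, u x * u x := by
  set ν := (volume : Measure (EuclideanSpace ℝ (Fin n))).restrict (ball 0 1) with hν
  have hui : Integrable fun x => u x ^ 2 :=
    Continuous.integrable_of_hasCompactSupport (by fun_prop)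
      (hs.comp_left (g := fun t : ℝ => t ^ 2) (by simp))
  have hFi : Integrable (Function.uncurry fun ξ y : EuclideanSpace ℝ (Fin n) =>
      u (ξ + R • y) ^ 2) (volume.prod ν) := by
    rw [integrable_prod_iff' (Continuous.aestronglyMeasurable
      (by unfold Function.uncurry; fun_prop))]
    refine ⟨Filter.Eventually.of_forall fun y => hui.comp_add_right (R • y), ?_⟩
    have : ∀ y, ∫ ξ, ‖u (ξ + R • y) ^ 2‖ = ∫ x, ‖u x ^ 2‖ := fun y =>
      integral_add_right_eq_self (fun x => ‖u x ^ 2‖) _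
    simp only [Function.uncurry, this]
    have : IsFiniteMeasure ν := ⟨by simpa [hν] using measure_ball_lt_top⟩
    exact integrable_const _
  refine ⟨hFi.integral_prod_left, ?_⟩
  rw [integral_integral_swap hFi]
  have : ∀ y, ∫ ξ, u (ξ + R • y) ^ 2 = ∫ x, u x ^ 2 := fun y =>
      integral_add_right_eq_self (fun x => u x ^ 2) _
  simp_rw [this, ← sq]
  simp [hν]

lemma integral_affineDefect_translate {u : EuclideanSpace ℝ (Fin n) → ℝ} (hu : Continuous u)
    (hs : HasCompactSupport u) {w : EuclideanSpace ℝ (Fin n) → ℝ} (hwi : Integrable w)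
    (hA : ∀ h, ∫ x, u x * u (x + h) = ∫ ζ, w ζ * Real.cos (2 * Real.pi * ⟪h, ζ⟫)) (R : ℝ) :
    Integrable (fun ξ => affineDefect fun y => u (ξ + R • y)) ∧
    ∫ ξ, (affineDefect fun y => u (ξ + R • y)) = ∫ ζ, w ζ * waveDefect (R • ζ) := by
  obtain ⟨hi0, he0⟩ := integral_setIntegral_sq_translate hu hs R
  obtain ⟨hi1, hj1, he1⟩ := integral_sq_setIntegral_translate hu hs hwi hA R
    (g := fun _ => 1) continuous_const
  simp only [mul_one] at hi1 hj1 he1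
  have h2 := fun i : Fin n => integral_sq_setIntegral_translate hu hs hwi hA R
    (g := fun y => y i) (by fun_prop)
  have hi2 := integrable_finsetSum Finset.univ fun i _ => (h2 i).1
  have hj2 := integrable_finsetSum Finset.univ fun i _ => (h2 i).2.1
  have he2 := Finset.sum_congr rfl fun i (_ : i ∈ Finset.univ) => (h2 i).2.2
  rw [← integral_finsetSum _ fun i _ => (h2 i).1,
    ← integral_finsetSum _ fun i _ => (h2 i).2.1] at he2
  have hA0 := hA 0
  simp only [add_zero, inner_zero_left, mul_zero, Real.cos_zero, mul_one] at hA0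
  have hwave : ∀ ζ, w ζ * waveDefect (R • ζ) =
      volume.real (ball (0 : EuclideanSpace ℝ (Fin n)) 1) * w ζ
      - (volume.real (ball (0 : EuclideanSpace ℝ (Fin n)) 1))⁻¹ *
        (w ζ * ((∫ y in ball 0 1, Real.cos (2 * Real.pi * ⟪y, R • ζ⟫)) ^ 2 +
        (∫ y in ball 0 1, Real.sin (2 * Real.pi * ⟪y, R • ζ⟫)) ^ 2))
      - (ballMoment n)⁻¹ * ∑ i,
        (w ζ * ((∫ y in ball 0 1, Real.cos (2 * Real.pi * ⟪y, R • ζ⟫) * y i) ^ 2 +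
        (∫ y in ball 0 1, Real.sin (2 * Real.pi * ⟪y, R • ζ⟫) * y i) ^ 2)) := by
    intro ζ
    have h1 : (∫ y in ball 0 1, Real.cos (2 * Real.pi * ⟪y, R • ζ⟫) ^ 2) +
        (∫ y in ball 0 1, Real.sin (2 * Real.pi * ⟪y, R • ζ⟫) ^ 2) =
        volume.real (ball (0 : EuclideanSpace ℝ (Fin n)) 1) := by
      rw [← integral_add (Continuous.integrableOn_euclidean_ball (by fun_prop) _ _)
        (Continuous.integrableOn_euclidean_ball (by fun_prop) _ _)]
      simp
    rw [← Finset.mul_sum, Finset.sum_add_distrib, waveDefect, affineDefect, affineDefect]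
    linear_combination (w ζ) * h1
  simp_rw [hwave]
  unfold affineDefect
  refine ⟨(hi0.sub (hi1.const_mul _)).sub (hi2.const_mul _), ?_⟩
  beta_reduce
  have ha := hi0.sub (hi1.const_mul (volume.real (ball (0 : EuclideanSpace ℝ (Fin n)) 1))⁻¹)
  have hb := (hwi.const_mul (volume.real (ball (0 : EuclideanSpace ℝ (Fin n)) 1))).sub
    (hj1.const_mul (volume.real (ball (0 : EuclideanSpace ℝ (Fin n)) 1))⁻¹)
  simp only [Pi.sub_def] at ha hb
  rw [integral_sub ha (hi2.const_mul _), integral_sub hi0 (hi1.const_mul _),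
    integral_sub hb (hj2.const_mul _), integral_sub (hwi.const_mul _) (hj1.const_mul _)]
  simp only [integral_const_mul]
  rw [he0, he1, he2, hA0]

lemma integral_integral_affineDefect (hn : 0 < n) {e : EuclideanSpace ℝ (Fin n)} (he : ‖e‖ = 1)
    {u : EuclideanSpace ℝ (Fin n) → ℝ} (hu : Continuous u)
    (hs : HasCompactSupport u) {w : EuclideanSpace ℝ (Fin n) → ℝ} (hw : ∀ ζ, 0 ≤ w ζ)
    (hwc : Continuous w) (hwi : Integrable w)
    (hA : ∀ h, ∫ x, u x * u (x + h) = ∫ ζ, w ζ * Real.cos (2 * Real.pi * ⟪h, ζ⟫))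
    (hw2 : Integrable fun ζ => w ζ * ‖ζ‖ ^ 2) :
    ∫ ξ, ∫ R in Set.Ioi (0 : ℝ), (affineDefect fun y => u (ξ + R • y)) / R ^ 3 =
      waveConst e * ∫ ζ, w ζ * ‖ζ‖ ^ 2 := by
  set ρ := (volume : Measure ℝ).restrict (Set.Ioi 0) with hρ
  set f : EuclideanSpace ℝ (Fin n) → ℝ → ℝ := fun ξ R =>
    (affineDefect fun y => u (ξ + R • y)) / R ^ 3 with hf
  set g : EuclideanSpace ℝ (Fin n) → ℝ → ℝ := fun ζ R =>
    w ζ * (waveDefect (R • ζ) / R ^ 3) with hg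
  have hR : ∀ᵐ R ∂ρ, (0 : ℝ) < R := ae_restrict_mem measurableSet_Ioi
  have hfm : AEStronglyMeasurable (Function.uncurry f) (volume.prod ρ) := by
    have h1 : Measurable fun p : EuclideanSpace ℝ (Fin n) × ℝ =>
        affineDefect fun y => u (p.1 + p.2 • y) := measurable_affineDefect (by fun_prop)
    exact (h1.div (by fun_prop)).aestronglyMeasurable
  have hgm : AEStronglyMeasurable (Function.uncurry g) (volume.prod ρ) := by
    have h1 : Measurable fun p : EuclideanSpace ℝ (Fin n) × ℝ => waveDefect (p.2 • p.1) :=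
      measurable_waveDefect.comp (by fun_prop)
    exact ((hwc.measurable.comp measurable_fst).mul (h1.div (by fun_prop))).aestronglyMeasurable
  have hg0 : ∀ ζ, ∀ᵐ R ∂ρ, 0 ≤ g ζ R := fun ζ => hR.mono fun R hR =>
    mul_nonneg (hw ζ) (div_nonneg (waveDefect_nonneg hn _) (by positivity))
  have hgint : ∀ ζ, ∫ R, g ζ R ∂ρ = waveConst e * (w ζ * ‖ζ‖ ^ 2) := fun ζ => by
    simp only [hg]
    rw [integral_const_mul, integral_waveDefect_smul hn he]
    ring
  have hgi : Integrable (Function.uncurry g) (volume.prod ρ) := by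
    rw [integrable_prod_iff hgm]
    refine ⟨Filter.Eventually.of_forall fun ζ =>
      Integrable.const_mul (integrableOn_waveDefect_smul hn he ζ) (w ζ), ?_⟩
    refine (hw2.const_mul (waveConst e)).congr (Filter.Eventually.of_forall fun ζ => ?_)
    change waveConst e * (w ζ * ‖ζ‖ ^ 2) = ∫ R, ‖g ζ R‖ ∂ρ
    rw [← hgint]
    exact integral_congr_ae ((hg0 ζ).mono fun R h => (Real.norm_of_nonneg h).symm)
  have hfR : ∀ R, Integrable (fun ξ => f ξ R) ∧ ∫ ξ, f ξ R = ∫ ζ, g ζ R := fun R => by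
    obtain ⟨h1, h2⟩ := integral_affineDefect_translate hu hs hwi hA R
    refine ⟨h1.div_const _, ?_⟩
    simp only [hf, hg]
    simp_rw [← mul_div_assoc]
    rw [integral_div, integral_div, h2]
  have hfi : Integrable (Function.uncurry f) (volume.prod ρ) := by
    rw [integrable_prod_iff' hfm]
    refine ⟨Filter.Eventually.of_forall fun R => (hfR R).1, ?_⟩
    refine hgi.integral_prod_right.congr (hR.mono fun R hR => ?_)
    change ∫ ζ, g ζ R = ∫ ξ, ‖f ξ R‖
    rw [← (hfR R).2]
    exact integral_congr_ae (Filter.Eventually.of_forall fun ξ => (Real.norm_of_nonneg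
      (div_nonneg (affineDefect_nonneg hn (by fun_prop)) (by positivity))).symm)
  rw [integral_integral_swap hfi]
  simp_rw [(hfR _).2]
  rw [← integral_integral_swap hgi]
  simp_rw [hgint]
  rw [integral_const_mul]

end Assembly

/-- the basic identity.  There is a constant `c_n > 0` depending only on `n`
such that for every compactly supported Lipschitz `u : ℝⁿ → ℝ`,
`∫ |∇u|² = c_n ∫_ξ ∫_{R>0} R^{-(n+2)} ( ∫_{B(ξ,R)} |u − L_{ξ,R}|² ) dR/R dξ`,
where `L_{ξ,R}` best approximates `u` in `L²(B(ξ,R))`.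
(Here `R^{-(n+2)} · (·) · (1/R)` is written as division by `R^{n+3}`.) -/
theorem basic_identity (n : ℕ) :
    ∃ c : ℝ, 0 < c ∧
      ∀ (u : EuclideanSpace ℝ (Fin n) → ℝ),
        (∃ K : ℝ≥0, LipschitzWith K u) →
        HasCompactSupport u →
        ∀ L : EuclideanSpace ℝ (Fin n) → ℝ → EuclideanSpace ℝ (Fin n) → ℝ,
          (∀ ξ R, 0 < R → IsBestAffineApprox u (ball ξ R) (L ξ R)) →
          ∫ x, ‖fderiv ℝ u x‖ ^ 2 ∂volume =
            c * ∫ ξ, (∫ R in Set.Ioi (0 : ℝ),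
              (∫ x in ball ξ R, (u x - L ξ R x) ^ 2 ∂volume) / R ^ (n + 3)) ∂volume := by
  rcases Nat.eq_zero_or_pos n with rfl | hn
  · refine ⟨1, one_pos, fun u _ _ L hL => ?_⟩
    have h1 : ∀ x, ‖fderiv ℝ u x‖ ^ 2 = 0 := fun x => by
      rw [Subsingleton.elim (fderiv ℝ u x) 0]; simp
    have h2 : ∀ ξ, ∀ R ∈ Set.Ioi (0 : ℝ),
        (∫ x in ball ξ R, (u x - L ξ R x) ^ 2) / R ^ (0 + 3) = 0 := fun ξ R hR => by
      have h3 := (hL ξ R hR).2 (fun _ => u 0) ⟨0, u 0, by simp⟩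
      have h4 : ∀ x, (u x - u 0) ^ 2 = 0 := fun x => by
        rw [Subsingleton.elim x 0]; simp
      simp only [h4, integral_zero] at h3
      rw [le_antisymm h3 (integral_nonneg fun x => sq_nonneg _), zero_div]
    simp_rw [h1, setIntegral_congr_fun measurableSet_Ioi (h2 _)]
    simp
  · set e : EuclideanSpace ℝ (Fin n) := EuclideanSpace.single ⟨0, hn⟩ 1
    have he : ‖e‖ = 1 := by simp [e]
    have hC := waveConst_pos hn he
    refine ⟨(2 * Real.pi) ^ 2 / waveConst e, by positivity, ?_⟩
    rintro u ⟨K, hu⟩ hs L hL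
    obtain ⟨w, hw, hwc, hwi, hA⟩ := exists_spectral_density hu.continuous hs
    obtain ⟨hw2, hgrad⟩ := integral_sq_norm_fderiv_eq hu hs hw hwc hwi hA
    have h2 : ∀ ξ, ∀ R ∈ Set.Ioi (0 : ℝ), (∫ x in ball ξ R, (u x - L ξ R x) ^ 2) / R ^ (n + 3) =
        (affineDefect fun y => u (ξ + R • y)) / R ^ 3 := fun ξ R hR => by
      have hR0 : (0 : ℝ) < R := hR
      rw [(hL ξ R hR).setIntegral_sq_sub hn hu.continuous hR, pow_add]
      field_simp
    simp_rw [setIntegral_congr_fun measurableSet_Ioi (h2 _)]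
    rw [hgrad, integral_integral_affineDefect hn he hu.continuous hs hw hwc hwi hA hw2]
    field_simp
end
end
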